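/- arXiv:2208.09426 — 2 statements merged into one kernel-verified Lean document; each statement's English description precedes it below -/
import Mathlib

section
/- Let X_1, X_2, ... be i.i.d. random vectors in R^q and let f : R^q → R^r be measurable with E‖f(X_1 - X_2)‖² < ∞. Fix an integer d ≥ 1 and define M_{n,d} := (nd)^{-1} Σ_{i=1}^n Σ_{j=i+1}^{i+d} f_2(X_i, X_j) with cyclic indexing X_{n+s} := X_s. Then, as n → ∞, the random pair ( √n · n^{-1} Σ_{i=1}^n f_1(X_i), √(nd) · M_{n,d} ) converges in distribution to the product measure N_r(0, Γ_1) ⊗ N_r(0, Γ_2), i.e. to a pair of independent centered Gaussian random vectors in R^r with covariance matrices Γ_1 and Γ_2 respectively. -/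
open MeasureTheory ProbabilityTheory Finset Filter
open scoped ENNReal Topology RealInnerProductSpace

noncomputable section

/-- Symmetrization `f^s(x) := (f(x) + f(-x))/2`. -/
def fS {q r : ℕ} (f : EuclideanSpace ℝ (Fin q) → EuclideanSpace ℝ (Fin r))
    (x : EuclideanSpace ℝ (Fin q)) : EuclideanSpace ℝ (Fin r) :=
  (2 : ℝ)⁻¹ • (f x + f (-x))

/-- `f_0 := E f(X_1 - X_2)`. -/
def f0v {Ω : Type*} [MeasurableSpace Ω] {q r : ℕ} (P : Measure Ω)
    (X : ℕ → Ω → EuclideanSpace ℝ (Fin q))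
    (f : EuclideanSpace ℝ (Fin q) → EuclideanSpace ℝ (Fin r)) : EuclideanSpace ℝ (Fin r) :=
  ∫ ω, f (X 0 ω - X 1 ω) ∂P

/-- `f_1(x) := E f^s(x - X_1) - f_0`. -/
def f1v {Ω : Type*} [MeasurableSpace Ω] {q r : ℕ} (P : Measure Ω)
    (X : ℕ → Ω → EuclideanSpace ℝ (Fin q))
    (f : EuclideanSpace ℝ (Fin q) → EuclideanSpace ℝ (Fin r))
    (x : EuclideanSpace ℝ (Fin q)) : EuclideanSpace ℝ (Fin r) :=
  (∫ ω, fS f (x - X 0 ω) ∂P) - f0v P X f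

/-- `f_2(x,y) := f^s(x - y) - f_0 - f_1(x) - f_1(y)`. -/
def f2v {Ω : Type*} [MeasurableSpace Ω] {q r : ℕ} (P : Measure Ω)
    (X : ℕ → Ω → EuclideanSpace ℝ (Fin q))
    (f : EuclideanSpace ℝ (Fin q) → EuclideanSpace ℝ (Fin r))
    (x y : EuclideanSpace ℝ (Fin q)) : EuclideanSpace ℝ (Fin r) :=
  fS f (x - y) - f0v P X f - f1v P X f x - f1v P X f y

/-- The covariance matrix of an `ℝ^r`-valued random vector. -/
def covM {Ω : Type*} [MeasurableSpace Ω] {r : ℕ} (P : Measure Ω)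
    (Y : Ω → EuclideanSpace ℝ (Fin r)) : Matrix (Fin r) (Fin r) ℝ :=
  Matrix.of fun a b =>
    ∫ ω, (Y ω a - ∫ ω', Y ω' a ∂P) * (Y ω b - ∫ ω', Y ω' b ∂P) ∂P

/-- Loewner partial order: `A ≤ B` iff `B - A` is positive semidefinite. -/
def LoewnerLE {r : ℕ} (A B : Matrix (Fin r) (Fin r) ℝ) : Prop := (B - A).PosSemidef


/-- The quadratic form `a ↦ aᵀ Γ a` of a covariance matrix. -/
def quadForm {r : ℕ} (Γ : Matrix (Fin r) (Fin r) ℝ) (a : EuclideanSpace ℝ (Fin r)) : ℝ :=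
  ∑ i, ∑ j, a i * Γ i j * a j

lemma cf_diff_le {Ω : Type*} [MeasurableSpace Ω] (P : Measure Ω) [IsProbabilityMeasure P]
    {S T : Ω → ℝ} (hS : AEMeasurable S P) (hT : AEMeasurable T P)
    (hi : Integrable (fun ω => S ω - T ω) P) :
    ‖(∫ ω, Complex.exp (Complex.I * (S ω : ℂ)) ∂P) - ∫ ω, Complex.exp (Complex.I * (T ω : ℂ)) ∂P‖
      ≤ ∫ ω, |S ω - T ω| ∂P := by
  have hint : ∀ {S : Ω → ℝ}, AEMeasurable S P →
      Integrable (fun ω => Complex.exp (Complex.I * (S ω : ℂ))) P := by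
    intro S hS
    refine Integrable.of_bound (C := 1) (by fun_prop) ?_
    refine ae_of_all _ fun ω => ?_
    rw [mul_comm, Complex.norm_exp_ofReal_mul_I]
  rw [← integral_sub (hint hS) (hint hT)]
  refine (norm_integral_le_integral_norm _).trans ?_
  refine integral_mono_of_nonneg (ae_of_all _ fun _ => norm_nonneg _) hi.abs
    (ae_of_all _ fun ω => ?_)
  have : Complex.exp (Complex.I * (S ω : ℂ)) - Complex.exp (Complex.I * (T ω : ℂ))
      = Complex.exp (Complex.I * (T ω : ℂ)) *
        (Complex.exp (Complex.I * ((S ω - T ω : ℝ) : ℂ)) - 1) := by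
    rw [mul_sub, ← Complex.exp_add]; push_cast; ring_nf
  simp only
  rw [this, norm_mul, mul_comm Complex.I, Complex.norm_exp_ofReal_mul_I, one_mul]
  exact Real.norm_exp_I_mul_ofReal_sub_one_le

lemma sq_int_abs_le {Ω : Type*} [MeasurableSpace Ω] (P : Measure Ω) [IsProbabilityMeasure P]
    {S : Ω → ℝ} (hS : MemLp S 2 P) : (∫ ω, |S ω| ∂P) ^ 2 ≤ ∫ ω, S ω ^ 2 ∂P := by
  have h1 := variance_nonneg (fun ω => |S ω|) P
  have hS' : MemLp (fun ω => |S ω|) 2 P := hS.norm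
  rw [variance_eq_sub hS'] at h1
  simp only [Pi.pow_apply, sq_abs] at h1
  linarith

/-- Blocks of an iid sequence are iid. -/
lemma blocks_iid {E Ω : Type*} [MeasurableSpace E] [MeasurableSpace Ω] (P : Measure Ω)
    [IsProbabilityMeasure P]
    (X : ℕ → Ω → E) (hXm : ∀ i, Measurable (X i)) (hindep : iIndepFun X P)
    (hident : ∀ i, Measure.map (X i) P = Measure.map (X 0) P) (m : ℕ) (hm : 0 < m) :
    iIndepFun (fun k ω => fun s : Fin m => X (k * m + s) ω) P ∧
    ∀ k, IdentDistrib (fun ω => fun s : Fin m => X (k * m + s) ω)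
      (fun ω => fun s : Fin m => X (0 * m + s) ω) P P := by
  have hp : ∀ i, IsProbabilityMeasure (P.map (X i)) := fun i =>
    Measure.isProbabilityMeasure_map (hXm i).aemeasurable
  have hinj : Function.Injective (fun p : ℕ × Fin m => p.1 * m + (p.2 : ℕ)) := by
    rintro ⟨a, b⟩ ⟨c, e⟩ h
    simp only at h
    have h1 : a = c := by
      have := congrArg (· / m) h
      simpa [Nat.add_div_of_dvd_right, Nat.mul_div_cancel _ hm, Nat.div_eq_of_lt b.2,
        Nat.div_eq_of_lt e.2] using this
    subst h1
    have : (b : ℕ) = e := by omega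
    simp [Fin.ext_iff, this]
  have hmap : ∀ k, P.map (fun ω => fun s : Fin m => X (k * m + s) ω)
      = Measure.infinitePi (fun _ : Fin m => P.map (X 0)) := by
    intro k
    have : iIndepFun (fun s : Fin m => X (k * m + s)) P :=
      hindep.precomp (g := fun s : Fin m => k * m + (s : ℕ)) (by
        intro a b h; simpa [Fin.ext_iff] using h)
    have := this.map_fun_eq_infinitePi_map (fun i => hXm _)
    rw [this]; simp [hident]
  refine ⟨?_, fun k => ⟨by fun_prop, by fun_prop, by rw [hmap, hmap]⟩⟩
  rw [iIndepFun_iff_map_fun_eq_infinitePi_map (by fun_prop)]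
  simp_rw [hmap]
  have h2 : iIndepFun (fun p : ℕ × Fin m => X (p.1 * m + p.2)) P := hindep.precomp hinj
  have h3 := h2.map_fun_eq_infinitePi_map (fun i => hXm _)
  simp_rw [hident] at h3
  have h4 := Measure.infinitePi_map_curry (fun (_ : ℕ) (_ : Fin m) => P.map (X 0))
  rw [← h4, ← h3, Measure.map_map (by fun_prop) (by fun_prop)]
  rfl

section core
variable {Ω : Type*} [MeasurableSpace Ω] {P : Measure Ω} [IsProbabilityMeasure P]
  {Y : ℕ → Ω → ℝ} {σ2 : ℝ}

lemma int_sum_mul_sum (hL2 : ∀ i, MemLp (Y i) 2 P)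
    (horth : ∀ i k, i ≠ k → ∫ ω, Y i ω * Y k ω ∂P = 0)
    (hvar : ∀ i, ∫ ω, Y i ω ^ 2 ∂P = σ2) (A B : Finset ℕ) :
    ∫ ω, (∑ i ∈ A, Y i ω) * (∑ i ∈ B, Y i ω) ∂P = (#(A ∩ B) : ℝ) * σ2 := by
  simp_rw [Finset.sum_mul_sum]
  have hint : ∀ i j, Integrable (fun ω => Y i ω * Y j ω) P := fun i j => (hL2 i).integrable_mul (hL2 j)
  rw [integral_finsetSum _ fun i _ => integrable_finsetSum _ fun j _ => hint i j]
  simp_rw [integral_finsetSum _ fun j _ => hint _ j]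
  have : ∀ i j, ∫ ω, Y i ω * Y j ω ∂P = if i = j then σ2 else 0 := by
    intro i j
    split_ifs with h
    · subst h; simp_rw [← pow_two]; exact hvar i
    · exact horth i j h
  simp_rw [this]
  simp [Finset.sum_ite_eq]

lemma core_clt (d : ℕ) (hm : ∀ i, Measurable (Y i)) (hL2 : ∀ i, MemLp (Y i) 2 P)
    (hmean : ∀ i, ∫ ω, Y i ω ∂P = 0)
    (horth : ∀ i k, i ≠ k → ∫ ω, Y i ω * Y k ω ∂P = 0)
    (hvar : ∀ i, ∫ ω, Y i ω ^ 2 ∂P = σ2)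
    (hblock : ∀ m, d < m → iIndepFun (fun k ω => ∑ s ∈ range (m - d), Y (k * m + s) ω) P ∧
      ∀ k, IdentDistrib (fun ω => ∑ s ∈ range (m - d), Y (k * m + s) ω)
        (fun ω => ∑ s ∈ range (m - d), Y (0 * m + s) ω) P P) :
    Tendsto (fun n : ℕ => ∫ ω, Complex.exp (Complex.I *
      (((Real.sqrt n)⁻¹ * ∑ i ∈ range n, Y i ω : ℝ) : ℂ)) ∂P) atTop
      (𝓝 (Complex.exp (-(σ2 : ℂ) / 2))) := by
  have hσ : 0 ≤ σ2 := by rw [← hvar 0]; positivity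
  -- block index set
  let B : ℕ → ℕ → Finset ℕ := fun m L =>
    (range L ×ˢ range (m - d)).image fun p => p.1 * m + p.2
  have hBinj : ∀ m L, d < m → Set.InjOn (fun p : ℕ × ℕ => p.1 * m + p.2)
      (range L ×ˢ range (m - d) : Finset (ℕ × ℕ)) := by
    intro m L hdm
    rintro ⟨a, b⟩ h1 ⟨c, e⟩ h2 h
    simp only [coe_product, coe_range, Set.mem_prod, Set.mem_Iio] at h h1 h2
    have hb : b < m := by omega
    have he : e < m := by omega
    have h3 : a = c := by
      have := congrArg (· / m) h
      simpa [Nat.add_div_of_dvd_right, Nat.mul_div_cancel _ (by omega : 0 < m),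
        Nat.div_eq_of_lt hb, Nat.div_eq_of_lt he] using this
    subst h3
    simp; omega
  have hBcard : ∀ m L, d < m → #(B m L) = L * (m - d) := by
    intro m L hdm
    simp only [B]
    rw [Finset.card_image_of_injOn (hBinj m L hdm)]; simp
  have hBsum : ∀ m L, d < m → ∀ ω, ∑ i ∈ B m L, Y i ω =
      ∑ k ∈ range L, ∑ s ∈ range (m - d), Y (k * m + s) ω := by
    intro m L hdm ω
    simp only [B]
    rw [Finset.sum_image (hBinj m L hdm), Finset.sum_product]
  have hBsub : ∀ m n, d < m → B m (n / m) ⊆ range n := by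
    intro m n hdm x hx
    simp only [B, mem_image, mem_product, mem_range, Prod.exists] at hx ⊢
    obtain ⟨a, b, ⟨ha, hb⟩, rfl⟩ := hx
    have h1 : (a + 1) * m ≤ n / m * m := Nat.mul_le_mul_right _ ha
    have h2 := Nat.div_mul_le_self n m
    rw [add_mul] at h1
    omega
  have hsumL2 : ∀ A : Finset ℕ, MemLp (fun ω => ∑ i ∈ A, Y i ω) 2 P := fun A =>
    memLp_finsetSum _ fun i _ => hL2 i
  let S : ℕ → Ω → ℝ := fun n ω => (Real.sqrt n)⁻¹ * ∑ i ∈ range n, Y i ω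
  let T : ℕ → ℕ → Ω → ℝ := fun m L ω => (Real.sqrt m)⁻¹ * ((Real.sqrt L)⁻¹ * ∑ i ∈ B m L, Y i ω)
  -- the L2 distance
  have hdist : ∀ m, d < m → ∀ n, m ≤ n → ∫ ω, (S n ω - T m (n / m) ω) ^ 2 ∂P =
      σ2 * (1 - 2 * (1 - d / m) * Real.sqrt (((n / m : ℕ) : ℝ) * m / n) + (1 - d / m)) := by
    intro m hdm n hmn
    set L := n / m with hL
    have hLpos : 0 < L := Nat.div_pos hmn (by omega)
    have e1 : ∀ ω, (S n ω - T m L ω) ^ 2 =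
        (Real.sqrt n)⁻¹ ^ 2 * ((∑ i ∈ range n, Y i ω) * (∑ i ∈ range n, Y i ω))
        - 2 * (Real.sqrt n)⁻¹ * (Real.sqrt m)⁻¹ * (Real.sqrt L)⁻¹ *
          ((∑ i ∈ range n, Y i ω) * (∑ i ∈ B m L, Y i ω))
        + (Real.sqrt m)⁻¹ ^ 2 * (Real.sqrt L)⁻¹ ^ 2 *
          ((∑ i ∈ B m L, Y i ω) * (∑ i ∈ B m L, Y i ω)) := by
      intro ω; simp only [S, T]; ring
    simp_rw [e1]
    have hii : ∀ A C : Finset ℕ, Integrable (fun ω => (∑ i ∈ A, Y i ω) * (∑ i ∈ C, Y i ω)) P :=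
      fun A C => (hsumL2 A).integrable_mul (hsumL2 C)
    rw [integral_add, integral_sub]
    rotate_left
    · exact (hii _ _).const_mul _
    · exact (hii _ _).const_mul _
    · exact ((hii _ _).const_mul _).sub ((hii _ _).const_mul _)
    · exact (hii _ _).const_mul _
    simp_rw [integral_const_mul, int_sum_mul_sum hL2 horth hvar]
    have hBs : B m L ⊆ range n := hBsub m n hdm
    rw [Finset.inter_eq_right.2 hBs]
    simp only [Finset.inter_self, hBcard m L hdm, card_range]
    have hn0 : (0 : ℝ) < n := by exact_mod_cast (by omega : 0 < n)
    have hm0 : (0 : ℝ) < m := by exact_mod_cast (by omega : 0 < m)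
    have hL0 : (0 : ℝ) < L := by exact_mod_cast hLpos
    rw [Real.sqrt_div (by positivity), Real.sqrt_mul (by positivity)]
    push_cast [Nat.cast_sub hdm.le]
    have hn1 := Real.sq_sqrt hn0.le
    have hm1 := Real.sq_sqrt hm0.le
    have hL1 := Real.sq_sqrt hL0.le
    have hn2 := Real.sqrt_pos.2 hn0
    have hm2 := Real.sqrt_pos.2 hm0
    have hL2 := Real.sqrt_pos.2 hL0
    generalize Real.sqrt n = a at *
    generalize Real.sqrt m = b at *
    generalize Real.sqrt L = c at *
    rw [← hn1, ← hm1, ← hL1]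
    field_simp
  -- CLT for blocks
  have hclt : ∀ m, d < m → Tendsto (fun n : ℕ => ∫ ω, Complex.exp (Complex.I *
      ((T m (n / m) ω : ℝ) : ℂ)) ∂P) atTop
      (𝓝 (Complex.exp (-((σ2 * (1 - d / m) : ℝ) : ℂ) / 2))) := by
    intro m hdm
    obtain ⟨hb1, hb2⟩ := hblock m hdm
    set Z : ℕ → Ω → ℝ := fun k ω => ∑ s ∈ range (m - d), Y (k * m + s) ω with hZ
    have hm0 : (0 : ℝ) < m := by exact_mod_cast (by omega : 0 < m)
    have hZL2 : MemLp (Z 0) 2 P := memLp_finsetSum _ fun i _ => hL2 _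
    have hZ0 : ∫ ω, Z 0 ω ∂P = 0 := by
      simp only [hZ]
      rw [integral_finsetSum _ fun i _ => (hL2 _).integrable (by norm_num)]
      simp [hmean]
    have hZv : Var[Z 0; P] = (m - d) * σ2 := by
      rw [variance_eq_sub hZL2, hZ0]
      have := int_sum_mul_sum hL2 horth hvar (range (m - d)) (range (m - d))
      simp only [Finset.inter_self, card_range, ← pow_two] at this
      push_cast [Nat.cast_sub hdm.le] at this
      simp [hZ, this]
    have h := tendstoInDistribution_inv_sqrt_mul_sum_sub (P := P) (X := Z) (Y := id)
      (P' := gaussianReal 0 Var[Z 0; P].toNNReal) HasLaw.id hZL2 hb1 hb2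
    have h2 := ProbabilityMeasure.tendsto_iff_tendsto_charFun.1 h.tendsto (Real.sqrt m)⁻¹
    have h3 := h2.comp (Nat.tendsto_div_const_atTop (n := m) (by omega))
    simp only [ProbabilityMeasure.coe_mk, Measure.map_id] at h3
    rw [charFun_gaussianReal] at h3
    refine (h3.congr fun n => ?_).trans_eq ?_
    · simp only [Function.comp]
      rw [charFun_apply, integral_map (h.forall_aemeasurable _) (by fun_prop)]
      refine integral_congr_ae (ae_of_all _ fun ω => ?_)
      simp only [hZ0, mul_zero, sub_zero, T, hBsum m _ hdm]
      rw [mul_comm Complex.I]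
      congr 3
    · congr 2
      rw [hZv, Real.coe_toNNReal _ (mul_nonneg (by
        have : (d : ℝ) ≤ m := by exact_mod_cast hdm.le
        linarith) hσ)]
      have h5 := Real.sq_sqrt hm0.le
      have h6 : (((Real.sqrt m : ℝ) : ℂ)) ^ 2 = m := by exact_mod_cast h5
      have h7 : (m : ℂ) ≠ 0 := by exact_mod_cast hm0.ne'
      push_cast
      rw [inv_pow, h6]
      field_simp
      ring
  have hratio : ∀ m, 0 < m → Tendsto (fun n : ℕ => (((n / m : ℕ) : ℝ) * m / n)) atTop (𝓝 1) := by
    intro m hm0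
    have h1 : Tendsto (fun n : ℕ => 1 - (m : ℝ) / n) atTop (𝓝 1) := by
      simpa using (tendsto_const_div_atTop_nhds_zero_nat (m : ℝ)).const_sub 1
    refine tendsto_of_tendsto_of_tendsto_of_le_of_le' h1 tendsto_const_nhds ?_ ?_
    · filter_upwards [eventually_gt_atTop 0] with n hn
      have hn0 : (0 : ℝ) < n := by exact_mod_cast hn
      rw [le_div_iff₀ hn0, sub_mul, div_mul_cancel₀ _ hn0.ne']
      have : n ≤ n / m * m + m := by
        have := Nat.div_add_mod n m
        have := Nat.mod_lt n hm0
        rw [mul_comm]; omega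
      have : (n : ℝ) ≤ (n / m : ℕ) * m + m := by exact_mod_cast this
      linarith
    · filter_upwards [eventually_gt_atTop 0] with n hn
      have hn0 : (0 : ℝ) < n := by exact_mod_cast hn
      rw [div_le_one hn0]
      exact_mod_cast Nat.div_mul_le_self n m
  have hSm : ∀ n, Measurable (S n) := fun n => by fun_prop
  have hTm : ∀ m n, Measurable (T m n) := fun m n => by fun_prop
  have hSTL2 : ∀ m n, MemLp (fun ω => S n ω - T m (n / m) ω) 2 P := fun m n =>
    ((hsumL2 _).const_mul _).sub (((hsumL2 _).const_mul _).const_mul _)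
  have hdm0 : Tendsto (fun m : ℕ => (d : ℝ) / m) atTop (𝓝 0) :=
    tendsto_const_div_atTop_nhds_zero_nat (d : ℝ)
  have hg1 : Tendsto (fun m : ℕ => Real.sqrt (σ2 * (d / m))) atTop (𝓝 0) := by
    have := (hdm0.const_mul σ2).sqrt
    simpa using this
  have hg2 : Tendsto (fun m : ℕ => Complex.exp (-((σ2 * (1 - d / m) : ℝ) : ℂ) / 2)) atTop
      (𝓝 (Complex.exp (-(σ2 : ℂ) / 2))) := by
    have h1 : Tendsto (fun m : ℕ => σ2 * (1 - (d : ℝ) / m)) atTop (𝓝 σ2) := by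
      simpa using (hdm0.const_sub 1).const_mul σ2
    have hc : Continuous fun x : ℝ => Complex.exp (-(x : ℂ) / 2) := by fun_prop
    exact (hc.tendsto σ2).comp h1
  rw [Metric.tendsto_nhds]
  intro ε hε
  obtain ⟨m, ⟨hm1, hm2⟩, hdm⟩ := ((hg1.eventually (gt_mem_nhds (by positivity : 0 < ε / 3))).and
    (Metric.tendsto_nhds.1 hg2 (ε / 3) (by positivity))).and (eventually_gt_atTop d) |>.exists
  have hlim : Tendsto (fun n : ℕ => Real.sqrt (σ2 * (1 - 2 * (1 - d / m) *
      Real.sqrt (((n / m : ℕ) : ℝ) * m / n) + (1 - d / m)))) atTop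
      (𝓝 (Real.sqrt (σ2 * (d / m)))) := by
    have h := (((((hratio m (by omega)).sqrt.const_mul (2 * (1 - (d : ℝ) / m))).const_sub 1).add_const
      (1 - (d : ℝ) / m)).const_mul σ2).sqrt
    refine h.trans_eq ?_
    congr 3
    rw [Real.sqrt_one]; ring
  filter_upwards [hlim.eventually (gt_mem_nhds hm1),
    Metric.tendsto_nhds.1 (hclt m hdm) (ε / 3) (by positivity), eventually_ge_atTop m] with n h1 h2 h3
  have h4 := cf_diff_le P (hSm n).aemeasurable (hTm m (n / m)).aemeasurable
    ((hSTL2 m n).integrable (by norm_num))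
  have h5 := sq_int_abs_le P (hSTL2 m n)
  rw [hdist m hdm n h3] at h5
  have h6 := Real.le_sqrt_of_sq_le h5
  have h7 := dist_triangle4 (∫ ω, Complex.exp (Complex.I * (S n ω : ℂ)) ∂P)
    (∫ ω, Complex.exp (Complex.I * (T m (n / m) ω : ℂ)) ∂P)
    (Complex.exp (-((σ2 * (1 - d / m) : ℝ) : ℂ) / 2)) (Complex.exp (-(σ2 : ℂ) / 2))
  rw [dist_eq_norm (∫ ω, Complex.exp (Complex.I * (S n ω : ℂ)) ∂P)
    (∫ ω, Complex.exp (Complex.I * (T m (n / m) ω : ℂ)) ∂P)] at h7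
  refine lt_of_le_of_lt h7 ?_
  linarith
end core

section ustat
variable {E Ω : Type*} [MeasurableSpace E] [MeasurableSpace Ω] {P : Measure Ω}
    [IsProbabilityMeasure P] {X : ℕ → Ω → E}

lemma mp_one (hXm : ∀ i, Measurable (X i))
    (hident : ∀ i, Measure.map (X i) P = Measure.map (X 0) P) (i : ℕ) :
    MeasurePreserving (X i) P (P.map (X 0)) := ⟨hXm i, hident i⟩

lemma mp_two (hXm : ∀ i, Measurable (X i)) (hindep : iIndepFun X P)
    (hident : ∀ i, Measure.map (X i) P = Measure.map (X 0) P) {i j : ℕ} (hij : i ≠ j) :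
    MeasurePreserving (fun ω => (X i ω, X j ω)) P ((P.map (X 0)).prod (P.map (X 0))) := by
  refine ⟨by fun_prop, ?_⟩
  rw [(indepFun_iff_map_prod_eq_prod_map_map (hXm i).aemeasurable (hXm j).aemeasurable).1
    (hindep.indepFun hij), hident i, hident j]

lemma indep_excl (hXm : ∀ i, Measurable (X i)) (hindep : iIndepFun X P) (e : E)
    (S : Finset ℕ) {j : ℕ} (hj : j ∉ S) :
    IndepFun (fun ω (s : ℕ) => if s ∈ S then X s ω else e) (X j) P := by
  have h := hindep.indepFun_finset S {j} (by simpa using hj) hXm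
  have hψ : Measurable (fun v : ({j} : Finset ℕ) → E => v ⟨j, by simp⟩) :=
    measurable_pi_apply (X := fun _ : ({j} : Finset ℕ) => E) (⟨j, by simp⟩ : ({j} : Finset ℕ))
  have h2 := h.comp (φ := fun (v : S → E) (s : ℕ) => if hs : s ∈ S then v ⟨s, hs⟩ else e)
    (ψ := fun v : ({j} : Finset ℕ) → E => v ⟨j, by simp⟩) (by
      rw [measurable_pi_iff]
      intro s
      by_cases hs : s ∈ S
      · simp only [hs, dite_true]; fun_prop
      · simp only [hs, dite_false]; fun_prop) hψ
  convert! h2 using 1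

lemma orth_aux {F : Type*} [MeasurableSpace F] {V : Ω → F} {U : Ω → E}
    (hV : Measurable V) (hU : Measurable U) (hVU : IndepFun V U P)
    {φ : F → ℝ} (hφ : Measurable φ) {g : F → E → ℝ} (hg : Measurable (Function.uncurry g))
    (hint : Integrable (fun ω => φ (V ω) * g (V ω) (U ω)) P)
    (h0 : ∀ᵐ ω ∂P, ∫ y, g (V ω) y ∂(P.map U) = 0) :
    ∫ ω, φ (V ω) * g (V ω) (U ω) ∂P = 0 := by
  have : IsProbabilityMeasure (P.map U) := Measure.isProbabilityMeasure_map hU.aemeasurable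
  have : IsProbabilityMeasure (P.map V) := Measure.isProbabilityMeasure_map hV.aemeasurable
  have hmeas : Measurable (fun p : F × E => φ p.1 * g p.1 p.2) :=
    (hφ.comp measurable_fst).mul hg
  have hlaw := (indepFun_iff_map_prod_eq_prod_map_map hV.aemeasurable hU.aemeasurable).1 hVU
  have hVUm : Measurable (fun ω => (V ω, U ω)) := by fun_prop
  have e1 : ∫ ω, φ (V ω) * g (V ω) (U ω) ∂P
      = ∫ p, φ p.1 * g p.1 p.2 ∂((P.map V).prod (P.map U)) := by
    rw [← hlaw, integral_map hVUm.aemeasurable hmeas.aestronglyMeasurable]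
  have hint' : Integrable (fun p : F × E => φ p.1 * g p.1 p.2) ((P.map V).prod (P.map U)) := by
    rw [← hlaw, integrable_map_measure hmeas.aestronglyMeasurable hVUm.aemeasurable]
    exact hint
  rw [e1, integral_prod _ hint']
  simp only [integral_const_mul]
  have hm2 : StronglyMeasurable (fun v => ∫ y, g v y ∂(P.map U)) :=
    hg.stronglyMeasurable.integral_prod_right
  have hms : AEStronglyMeasurable (fun v => φ v * ∫ y, g v y ∂(P.map U)) (P.map V) :=
    hφ.aestronglyMeasurable.mul hm2.aestronglyMeasurable
  rw [integral_map hV.aemeasurable hms]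
  refine integral_eq_zero_of_ae ?_
  filter_upwards [h0] with ω hω
  simp [hω]

variable {h1 : E → ℝ} {h2 : E → E → ℝ}

lemma meas_h2 {α : Type*} [MeasurableSpace α] (hh2 : Measurable (Function.uncurry h2))
    {u v : α → E} (hu : Measurable u) (hv : Measurable v) :
    Measurable fun a => h2 (u a) (v a) := hh2.comp (hu.prodMk hv)

/-- non-cyclic summands -/
def Ysum (X : ℕ → Ω → E) (h1 : E → ℝ) (h2 : E → E → ℝ) (d i : ℕ) (ω : Ω) : ℝ :=
  h1 (X i ω) + ∑ j ∈ range d, h2 (X i ω) (X (i + (j + 1)) ω)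

lemma scalar_noncyclic (hXm : ∀ i, Measurable (X i)) (hindep : iIndepFun X P)
    (hident : ∀ i, Measure.map (X i) P = Measure.map (X 0) P)
    (hh1 : Measurable h1) (hh2 : Measurable (Function.uncurry h2))
    (hL1 : MemLp h1 2 (P.map (X 0))) (h10 : ∫ x, h1 x ∂(P.map (X 0)) = 0)
    (hL2 : MemLp (Function.uncurry h2) 2 ((P.map (X 0)).prod (P.map (X 0))))
    (hdeg : ∀ᵐ x ∂(P.map (X 0)), ∫ y, h2 x y ∂(P.map (X 0)) = 0)
    (hsymm : ∀ x y, h2 x y = h2 y x) (d : ℕ) :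
    Tendsto (fun n : ℕ => ∫ ω, Complex.exp (Complex.I *
      (((Real.sqrt n)⁻¹ * ∑ i ∈ range n, Ysum X h1 h2 d i ω : ℝ) : ℂ)) ∂P) atTop
      (𝓝 (Complex.exp (-((∫ ω, h1 (X 0 ω) ^ 2 ∂P + d * ∫ ω, h2 (X 0 ω) (X 1 ω) ^ 2 ∂P : ℝ) : ℂ) / 2))) := by
  have hpr : IsProbabilityMeasure (P.map (X 0)) :=
    Measure.isProbabilityMeasure_map (hXm 0).aemeasurable
  have hne : Nonempty Ω := P.nonempty_of_neZero
  obtain ⟨ω0⟩ := hne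
  let e : E := X 0 ω0
  have A1 : ∀ i, MemLp (fun ω => h1 (X i ω)) 2 P := fun i =>
    hL1.comp_measurePreserving (mp_one hXm hident i)
  have A2 : ∀ i j, i ≠ j → MemLp (fun ω => h2 (X i ω) (X j ω)) 2 P := fun i j hij =>
    hL2.comp_measurePreserving (mp_two hXm hindep hident hij)
  have hYL2 : ∀ i, MemLp (Ysum X h1 h2 d i) 2 P := fun i =>
    (A1 i).add (memLp_finsetSum _ fun j _ => A2 _ _ (by omega))
  have hYm : ∀ i, Measurable (Ysum X h1 h2 d i) := fun i =>
    (hh1.comp (hXm i)).add (Finset.measurable_sum _ fun j _ => meas_h2 hh2 (hXm _) (hXm _))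
  have hdegX : ∀ i, ∀ᵐ ω ∂P, ∫ y, h2 (X i ω) y ∂(P.map (X 0)) = 0 := fun i =>
    (mp_one hXm hident i).quasiMeasurePreserving.ae hdeg
  have hintX : ∀ i, ∀ᵐ ω ∂P, Integrable (fun y => h2 (X i ω) y) (P.map (X 0)) := fun i =>
    (mp_one hXm hident i).quasiMeasurePreserving.ae
      (hL2.integrable (by norm_num)).prod_right_ae
  have hYdeg : ∀ i, ∀ᵐ ω ∂P, ∫ y, (h1 y + ∑ j ∈ range d, h2 y (X (i + (j + 1)) ω))
      ∂(P.map (X 0)) = 0 := by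
    intro i
    filter_upwards [ae_all_iff.2 hdegX, ae_all_iff.2 hintX] with ω a b
    simp_rw [fun y k => hsymm y (X k ω)]
    rw [integral_add (hL1.integrable (by norm_num)) (integrable_finsetSum _ fun j _ => b _),
      integral_finsetSum _ fun j _ => b _, h10]
    simp [a]
  have hYorth' : ∀ i k, i < k → ∫ ω, Ysum X h1 h2 d k ω * Ysum X h1 h2 d i ω ∂P = 0 := by
    intro i k hik
    let S := Finset.Ioc i (k + d)
    have hi : i ∉ S := by simp [S]
    let V : Ω → ℕ → E := fun ω s => if s ∈ S then X s ω else e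
    have hV : Measurable V := by
      rw [measurable_pi_iff]; intro s
      by_cases hs : s ∈ S
      · simp only [V, hs, if_true]; exact hXm s
      · simp only [V, hs, if_false]; fun_prop
    have hVs : ∀ ω s, i < s → s ≤ k + d → V ω s = X s ω := fun ω s a b => by simp [V, S, a, b]
    let φ : (ℕ → E) → ℝ := fun v => h1 (v k) + ∑ j ∈ range d, h2 (v k) (v (k + (j + 1)))
    let g : (ℕ → E) → E → ℝ := fun v y => h1 y + ∑ j ∈ range d, h2 y (v (i + (j + 1)))
    have hφ : Measurable φ := (hh1.comp (measurable_pi_apply _)).add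
      (Finset.measurable_sum _ fun j _ => meas_h2 hh2 (measurable_pi_apply _) (measurable_pi_apply _))
    have hg : Measurable (Function.uncurry g) := (hh1.comp measurable_snd).add
      (Finset.measurable_sum _ fun j _ => meas_h2 hh2 measurable_snd
        ((measurable_pi_apply _).comp measurable_fst))
    have e1 : ∀ ω, φ (V ω) = Ysum X h1 h2 d k ω := by
      intro ω
      simp only [φ, Ysum]
      rw [hVs ω k hik (by omega)]
      congr 1
      refine Finset.sum_congr rfl fun j hj => ?_
      rw [mem_range] at hj
      rw [hVs ω _ (by omega) (by omega)]
    have e2 : ∀ ω y, g (V ω) y = h1 y + ∑ j ∈ range d, h2 y (X (i + (j + 1)) ω) := by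
      intro ω y
      simp only [g]
      congr 1
      refine Finset.sum_congr rfl fun j hj => ?_
      rw [mem_range] at hj
      rw [hVs ω _ (by omega) (by omega)]
    have key := orth_aux (P := P) hV (hXm i) (indep_excl hXm hindep e S hi) hφ hg
      (by simp_rw [e1, e2]; exact (hYL2 k).integrable_mul (hYL2 i))
      (by rw [hident i]; simp_rw [e2]; exact hYdeg i)
    simp_rw [e1, e2] at key
    exact key
  have hYorth : ∀ i k, i ≠ k → ∫ ω, Ysum X h1 h2 d i ω * Ysum X h1 h2 d k ω ∂P = 0 := by
    intro i k hik
    rcases lt_or_gt_of_ne hik with h | h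
    · simp_rw [mul_comm (Ysum X h1 h2 d i _)]; exact hYorth' i k h
    · exact hYorth' k i h
  have hYmean : ∀ i, ∫ ω, Ysum X h1 h2 d i ω ∂P = 0 := by
    intro i
    simp only [Ysum]
    rw [integral_add ((A1 i).integrable (by norm_num))
      (integrable_finsetSum _ fun j _ => (A2 _ _ (by omega)).integrable (by norm_num)),
      integral_finsetSum _ fun j _ => (A2 _ _ (by omega)).integrable (by norm_num)]
    have b1 : ∫ ω, h1 (X i ω) ∂P = 0 := by
      rw [← h10, ← hident i, integral_map (hXm i).aemeasurable hh1.aestronglyMeasurable]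
    rw [b1, zero_add]
    refine Finset.sum_eq_zero fun j _ => ?_
    have key := orth_aux (P := P) (hXm i) (hXm (i + (j + 1))) (hindep.indepFun (by omega))
      (φ := fun _ => 1) measurable_const hh2
      (by simp only [one_mul]; exact (A2 i (i + (j + 1)) (by omega)).integrable (by norm_num))
      (by rw [hident]; exact hdegX i)
    simpa using key
  have hYvar : ∀ i, ∫ ω, Ysum X h1 h2 d i ω ^ 2 ∂P =
      ∫ ω, h1 (X 0 ω) ^ 2 ∂P + d * ∫ ω, h2 (X 0 ω) (X 1 ω) ^ 2 ∂P := by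
    intro i
    let W : ℕ → Ω → ℝ := fun j ω => h2 (X i ω) (X (i + (j + 1)) ω)
    have hW : ∀ j, MemLp (W j) 2 P := fun j => A2 _ _ (by omega)
    have hWs : MemLp (fun ω => ∑ j ∈ range d, W j ω) 2 P := memLp_finsetSum _ fun j _ => hW j
    have hWv : ∀ j, ∫ ω, W j ω ^ 2 ∂P = ∫ ω, h2 (X 0 ω) (X 1 ω) ^ 2 ∂P := by
      have : ∀ a b, a ≠ b → ∫ ω, h2 (X a ω) (X b ω) ^ 2 ∂P =
          ∫ p, h2 p.1 p.2 ^ 2 ∂((P.map (X 0)).prod (P.map (X 0))) := by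
        intro a b hab
        have hmp := mp_two (P := P) hXm hindep hident hab
        rw [← hmp.map_eq, integral_map hmp.measurable.aemeasurable]
        exact (hh2.pow_const 2).aestronglyMeasurable
      intro j
      simp only [W]
      rw [this _ _ (by omega), this _ _ (by omega)]
    have hWo : ∀ j l, j ≠ l → ∫ ω, W j ω * W l ω ∂P = 0 := by
      intro j l hjl
      have key := orth_aux (P := P) (V := fun ω => (X i ω, X (i + (j + 1)) ω)) (by fun_prop)
        (hXm (i + (l + 1)))
        (hindep.indepFun_prodMk hXm i (i + (j + 1)) (i + (l + 1)) (by omega) (by omega))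
        (φ := fun p : E × E => h2 p.1 p.2) hh2 (g := fun p y => h2 p.1 y)
        (meas_h2 hh2 (measurable_fst.comp measurable_fst) measurable_snd)
        ((hW j).integrable_mul (hW l)) (by rw [hident]; exact hdegX i)
      exact key
    have hWh : ∀ l, ∫ ω, h1 (X i ω) * W l ω ∂P = 0 := fun l =>
      orth_aux (P := P) (hXm i) (hXm (i + (l + 1))) (hindep.indepFun (by omega)) hh1 hh2
        ((A1 i).integrable_mul (hW l)) (by rw [hident]; exact hdegX i)
    have hWW := int_sum_mul_sum hW hWo hWv (range d) (range d)
    have ex : ∀ ω, Ysum X h1 h2 d i ω ^ 2 = h1 (X i ω) ^ 2 + (2 * ∑ j ∈ range d, h1 (X i ω) * W j ω)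
        + (∑ j ∈ range d, W j ω) * (∑ j ∈ range d, W j ω) := by
      intro ω; rw [← Finset.mul_sum]; simp only [Ysum, W]; ring
    simp_rw [ex]
    have i2 : Integrable (fun ω => 2 * ∑ j ∈ range d, h1 (X i ω) * W j ω) P :=
      (integrable_finsetSum _ fun j _ => (A1 i).integrable_mul (hW j)).const_mul 2
    have i1 : Integrable (fun ω => h1 (X i ω) ^ 2) P := (A1 i).integrable_sq
    have i4 : Integrable (fun ω => h1 (X i ω) ^ 2 + (2 * ∑ j ∈ range d, h1 (X i ω) * W j ω)) P :=
      i1.add i2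
    have i6 : ∀ j ∈ range d, Integrable (fun ω => h1 (X i ω) * W j ω) P := fun j _ =>
      (A1 i).integrable_mul (hW j)
    have i5 : Integrable (fun ω => (∑ j ∈ range d, W j ω) * (∑ j ∈ range d, W j ω)) P :=
      hWs.integrable_mul hWs
    rw [integral_add i4 i5, hWW, integral_add i1 i2,
      integral_const_mul, integral_finsetSum _ i6]
    have i3 : ∫ ω, h1 (X i ω) ^ 2 ∂P = ∫ ω, h1 (X 0 ω) ^ 2 ∂P := by
      have hq : ∀ i, ∫ ω, h1 (X i ω) ^ 2 ∂P = ∫ x, h1 x ^ 2 ∂(P.map (X 0)) := by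
        intro i
        rw [← hident i, integral_map (hXm i).aemeasurable (hh1.pow_const 2).aestronglyMeasurable]
      rw [hq, hq]
    rw [i3]
    simp [hWh]
  refine core_clt (P := P) d hYm hYL2 hYmean hYorth hYvar ?_
  intro m hdm
  obtain ⟨hb1, hb2⟩ := blocks_iid P X hXm hindep hident m (by omega)
  let w : (Fin m → E) → ℕ → E := fun v s => if h : s < m then v ⟨s, h⟩ else e
  have hw : ∀ s, Measurable (fun v => w v s) := by
    intro s
    by_cases h : s < m
    · simp only [w, h, dite_true]; fun_prop
    · simp only [w, h, dite_false]; fun_prop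
  let H : (Fin m → E) → ℝ := fun v => ∑ s ∈ range (m - d),
    (h1 (w v s) + ∑ j ∈ range d, h2 (w v s) (w v (s + (j + 1))))
  have hH : Measurable H := Finset.measurable_sum _ fun s _ => (hh1.comp (hw s)).add
    (Finset.measurable_sum _ fun j _ => meas_h2 hh2 (hw _) (hw _))
  have hZ : (fun k ω => ∑ s ∈ range (m - d), Ysum X h1 h2 d (k * m + s) ω) =
      fun k => H ∘ (fun ω => fun s : Fin m => X (k * m + s) ω) := by
    funext k ω
    simp only [H, Function.comp, Ysum]
    have hwX : ∀ s, s < m → w (fun s : Fin m => X (k * m + s) ω) s = X (k * m + s) ω := by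
      intro s hs; simp [w, hs]
    refine Finset.sum_congr rfl fun s hs => ?_
    rw [mem_range] at hs
    rw [hwX s (by omega)]
    congr 1
    refine Finset.sum_congr rfl fun j hj => ?_
    rw [mem_range] at hj
    rw [hwX _ (by omega), add_assoc]
  constructor
  · rw [hZ]
    exact hb1.comp (fun _ => H) fun _ => hH
  · intro k
    have hk := congrFun hZ k
    have h0 := congrFun hZ 0
    beta_reduce at hk h0
    rw [hk, h0]
    exact (hb2 k).comp hH

end ustat

section cyc
variable {E Ω : Type*} [MeasurableSpace E] [MeasurableSpace Ω] {P : Measure Ω}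
    [IsProbabilityMeasure P] {X : ℕ → Ω → E} {h1 : E → ℝ} {h2 : E → E → ℝ}

lemma scalar_cyclic (hXm : ∀ i, Measurable (X i)) (hindep : iIndepFun X P)
    (hident : ∀ i, Measure.map (X i) P = Measure.map (X 0) P)
    (hh1 : Measurable h1) (hh2 : Measurable (Function.uncurry h2))
    (hL1 : MemLp h1 2 (P.map (X 0))) (h10 : ∫ x, h1 x ∂(P.map (X 0)) = 0)
    (hL2 : MemLp (Function.uncurry h2) 2 ((P.map (X 0)).prod (P.map (X 0))))
    (hdeg : ∀ᵐ x ∂(P.map (X 0)), ∫ y, h2 x y ∂(P.map (X 0)) = 0)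
    (hsymm : ∀ x y, h2 x y = h2 y x) (d : ℕ) :
    Tendsto (fun n : ℕ => ∫ ω, Complex.exp (Complex.I *
      (((Real.sqrt n)⁻¹ * (∑ i ∈ range n, h1 (X i ω) +
        ∑ p ∈ range n ×ˢ Icc 1 d, h2 (X p.1 ω) (X ((p.1 + p.2) % n) ω)) : ℝ) : ℂ)) ∂P) atTop
      (𝓝 (Complex.exp (-((∫ ω, h1 (X 0 ω) ^ 2 ∂P + d * ∫ ω, h2 (X 0 ω) (X 1 ω) ^ 2 ∂P : ℝ) : ℂ) / 2))) := by
  have hpr : IsProbabilityMeasure (P.map (X 0)) :=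
    Measure.isProbabilityMeasure_map (hXm 0).aemeasurable
  have base := scalar_noncyclic hXm hindep hident hh1 hh2 hL1 h10 hL2 hdeg hsymm d
  set C := ∫ p, |Function.uncurry h2 p| ∂((P.map (X 0)).prod (P.map (X 0))) with hC
  have hC0 : 0 ≤ C := by positivity
  have A2 : ∀ i j, i ≠ j → Integrable (fun ω => h2 (X i ω) (X j ω)) P := fun i j hij =>
    (hL2.comp_measurePreserving (mp_two hXm hindep hident hij)).integrable (by norm_num)
  have A3 : ∀ i j, i ≠ j → ∫ ω, |h2 (X i ω) (X j ω)| ∂P = C := by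
    intro a b hab
    have hmp := mp_two (P := P) hXm hindep hident hab
    rw [hC, ← hmp.map_eq, integral_map hmp.measurable.aemeasurable]
    · rfl
    · exact hh2.abs.aestronglyMeasurable
  have hsum : ∀ (n : ℕ) ω, ∑ p ∈ range n ×ˢ Icc 1 d, h2 (X p.1 ω) (X ((p.1 + p.2) % n) ω)
      = ∑ i ∈ range n, ∑ j ∈ range d, h2 (X i ω) (X ((i + (j + 1)) % n) ω) := by
    intro n ω
    rw [Finset.sum_product]
    refine Finset.sum_congr rfl fun i _ => ?_
    have : Icc 1 d = (range d).map (addRightEmbedding 1) := by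
      ext x; simp only [mem_Icc, Finset.mem_map, mem_range, addRightEmbedding_apply]
      constructor
      · rintro ⟨a, b⟩; exact ⟨x - 1, by omega, by omega⟩
      · rintro ⟨a, b, rfl⟩; omega
    rw [this, Finset.sum_map]
    rfl
  have hbound : ∀ n : ℕ, d < n → ‖(∫ ω, Complex.exp (Complex.I *
      (((Real.sqrt n)⁻¹ * (∑ i ∈ range n, h1 (X i ω) +
        ∑ p ∈ range n ×ˢ Icc 1 d, h2 (X p.1 ω) (X ((p.1 + p.2) % n) ω)) : ℝ) : ℂ)) ∂P) -
      ∫ ω, Complex.exp (Complex.I *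
      (((Real.sqrt n)⁻¹ * ∑ i ∈ range n, Ysum X h1 h2 d i ω : ℝ) : ℂ)) ∂P‖
      ≤ (Real.sqrt n)⁻¹ * (d * (d * (2 * C))) := by
    intro n hdn
    have hmod : ∀ i ∈ range n, ∀ j ∈ range d, i ≠ (i + (j + 1)) % n := by
      intro i hi j hj
      rw [mem_range] at hi hj
      by_cases h : i + (j + 1) < n
      · rw [Nat.mod_eq_of_lt h]; omega
      · rw [Nat.mod_eq_sub_mod (by omega), Nat.mod_eq_of_lt (by omega)]; omega
    let D : ℕ → ℕ → Ω → ℝ := fun i j ω =>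
      h2 (X i ω) (X ((i + (j + 1)) % n) ω) - h2 (X i ω) (X (i + (j + 1)) ω)
    have hD0 : ∀ i j ω, i < n - d → j < d → D i j ω = 0 := by
      intro i j ω hi hj
      simp only [D]
      rw [Nat.mod_eq_of_lt (by omega), sub_self]
    have hDi : ∀ i ∈ range n, ∀ j ∈ range d, Integrable (D i j) P := fun i hi j hj =>
      (A2 _ _ (hmod i hi j hj)).sub (A2 _ _ (by omega))
    have hDb : ∀ i ∈ range n, ∀ j ∈ range d, ∫ ω, |D i j ω| ∂P ≤ 2 * C := by
      intro i hi j hj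
      have a1 := A2 _ _ (hmod i hi j hj)
      have a2 := A2 i (i + (j + 1)) (by omega)
      calc ∫ ω, |D i j ω| ∂P ≤ ∫ ω, (|h2 (X i ω) (X ((i + (j + 1)) % n) ω)| +
            |h2 (X i ω) (X (i + (j + 1)) ω)|) ∂P :=
            integral_mono (hDi i hi j hj).abs (a1.abs.add a2.abs) fun ω => abs_sub _ _
        _ = 2 * C := by
            rw [integral_add a1.abs a2.abs, A3 _ _ (hmod i hi j hj), A3 _ _ (by omega)]; ring
    have hdiff : ∀ ω, ((Real.sqrt n)⁻¹ * (∑ i ∈ range n, h1 (X i ω) +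
        ∑ p ∈ range n ×ˢ Icc 1 d, h2 (X p.1 ω) (X ((p.1 + p.2) % n) ω))) -
        ((Real.sqrt n)⁻¹ * ∑ i ∈ range n, Ysum X h1 h2 d i ω) =
        (Real.sqrt n)⁻¹ * ∑ i ∈ Ico (n - d) n, ∑ j ∈ range d, D i j ω := by
      intro ω
      rw [hsum]
      have : ∑ i ∈ range n, ∑ j ∈ range d, D i j ω = ∑ i ∈ Ico (n - d) n, ∑ j ∈ range d, D i j ω := by
        symm
        refine Finset.sum_subset (fun x hx => by rw [mem_Ico] at hx; rw [mem_range]; omega) ?_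
        intro i hi hi'
        rw [mem_range] at hi
        rw [mem_Ico] at hi'
        exact Finset.sum_eq_zero fun j hj => hD0 i j ω (by omega) (mem_range.1 hj)
      rw [← this]
      simp only [Ysum, D, Finset.sum_sub_distrib, Finset.sum_add_distrib]
      ring
    have hsub : ∀ i ∈ Ico (n - d) n, i ∈ range n := fun i hi => by
      rw [mem_Ico] at hi; rw [mem_range]; omega
    have hii : Integrable (fun ω => (Real.sqrt n)⁻¹ * ∑ i ∈ Ico (n - d) n, ∑ j ∈ range d, D i j ω) P :=
      (integrable_finsetSum _ fun i hi => integrable_finsetSum _ fun j hj =>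
        hDi i (hsub i hi) j hj).const_mul _
    refine (cf_diff_le P ?_ ?_ ?_).trans ?_
    · refine Measurable.aemeasurable (Measurable.const_mul (Measurable.add ?_ ?_) _)
      · exact Finset.measurable_sum _ fun i _ => hh1.comp (hXm i)
      · exact Finset.measurable_sum _ fun p _ => meas_h2 hh2 (hXm _) (hXm _)
    · refine Measurable.aemeasurable (Measurable.const_mul ?_ _)
      exact Finset.measurable_sum _ fun i _ => (hh1.comp (hXm i)).add
        (Finset.measurable_sum _ fun j _ => meas_h2 hh2 (hXm _) (hXm _))
    · simp_rw [hdiff]; exact hii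
    · simp_rw [hdiff]
      have hij : ∀ i ∈ Ico (n - d) n, Integrable (fun ω => ∑ j ∈ range d, |D i j ω|) P :=
        fun i hi => integrable_finsetSum _ fun j hj => (hDi i (hsub i hi) j hj).abs
      calc ∫ ω, |(Real.sqrt n)⁻¹ * ∑ i ∈ Ico (n - d) n, ∑ j ∈ range d, D i j ω| ∂P
          ≤ ∫ ω, (Real.sqrt n)⁻¹ * ∑ i ∈ Ico (n - d) n, ∑ j ∈ range d, |D i j ω| ∂P := by
            refine integral_mono hii.abs ((integrable_finsetSum _ hij).const_mul _) fun ω => ?_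
            simp only [abs_mul]
            rw [abs_of_nonneg (by positivity : 0 ≤ (Real.sqrt n)⁻¹)]
            gcongr
            refine (Finset.abs_sum_le_sum_abs _ _).trans (Finset.sum_le_sum fun i _ => ?_)
            exact Finset.abs_sum_le_sum_abs _ _
        _ = (Real.sqrt n)⁻¹ * ∑ i ∈ Ico (n - d) n, ∑ j ∈ range d, ∫ ω, |D i j ω| ∂P := by
            rw [integral_const_mul, integral_finsetSum _ hij]
            congr 1
            refine Finset.sum_congr rfl fun i hi => ?_
            rw [integral_finsetSum]
            exact fun j hj => (hDi i (hsub i hi) j hj).abs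
        _ ≤ (Real.sqrt n)⁻¹ * ∑ i ∈ Ico (n - d) n, ∑ j ∈ range d, 2 * C := by
            gcongr with i hi j hj
            exact hDb i (hsub i hi) j hj
        _ = _ := by
            simp only [Finset.sum_const, card_range, Nat.card_Ico, nsmul_eq_mul]
            rw [show n - (n - d) = d by omega]
  have h0 : Tendsto (fun n : ℕ => (Real.sqrt n)⁻¹ * (d * (d * (2 * C)))) atTop (𝓝 0) := by
    have : Tendsto (fun n : ℕ => (Real.sqrt n)⁻¹) atTop (𝓝 0) :=
      tendsto_inv_atTop_zero.comp (Real.tendsto_sqrt_atTop.comp tendsto_natCast_atTop_atTop)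
    simpa using this.mul_const (d * (d * (2 * C)))
  have hd0 := squeeze_zero_norm' (eventually_atTop.2 ⟨d + 1, fun n hn => hbound n (by omega)⟩) h0
  simpa using hd0.add base

end cyc

section hoeff
variable {E H : Type*} [MeasurableSpace E] [NormedAddCommGroup H] [NormedSpace ℝ H]
  [CompleteSpace H]
  {μ : Measure E} [IsProbabilityMeasure μ] {F : E → E → H}

lemma hoeff_meas (hF : StronglyMeasurable (Function.uncurry F)) (c : H) :
    StronglyMeasurable (fun x => ∫ y, F x y ∂μ - c) :=
  hF.integral_prod_right.sub stronglyMeasurable_const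

lemma hoeff_memLp (hF : StronglyMeasurable (Function.uncurry F))
    (hL : MemLp (Function.uncurry F) 2 (μ.prod μ)) (c : H) :
    MemLp (fun x => ∫ y, F x y ∂μ - c) 2 μ := by
  refine MemLp.sub ?_ (memLp_const c)
  rw [memLp_two_iff_integrable_sq_norm hF.integral_prod_right.aestronglyMeasurable]
  have hsq : Integrable (fun p : E × E => ‖F p.1 p.2‖ ^ 2) (μ.prod μ) :=
    (memLp_two_iff_integrable_sq_norm hF.aestronglyMeasurable).1 hL
  refine Integrable.mono' hsq.integral_prod_left
    (hF.integral_prod_right.norm.pow 2).aestronglyMeasurable ?_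
  filter_upwards [hsq.prod_right_ae] with x hx
  have hFx : StronglyMeasurable (F x) := hF.comp_measurable (measurable_const.prodMk measurable_id)
  have hm : MemLp (fun y => ‖F x y‖) 2 μ :=
    ((memLp_two_iff_integrable_sq_norm hFx.aestronglyMeasurable).2 hx).norm
  have h1 := sq_int_abs_le μ hm
  simp only [abs_norm] at h1
  rw [Real.norm_of_nonneg (by positivity)]
  refine le_trans ?_ h1
  gcongr
  exact norm_integral_le_integral_norm _

lemma hoeff_mean (hL : MemLp (Function.uncurry F) 2 (μ.prod μ)) :
    ∫ x, (∫ y, F x y ∂μ - ∫ p, F p.1 p.2 ∂(μ.prod μ)) ∂μ = 0 := by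
  have hi : Integrable (fun p : E × E => F p.1 p.2) (μ.prod μ) := hL.integrable (by norm_num)
  rw [integral_sub hi.integral_prod_left (integrable_const _), integral_prod _ hi]
  simp

lemma hoeff2_memLp (hF : StronglyMeasurable (Function.uncurry F))
    (hL : MemLp (Function.uncurry F) 2 (μ.prod μ)) (c : H) :
    MemLp (fun p : E × E => F p.1 p.2 - c - (∫ y, F p.1 y ∂μ - c) - (∫ y, F p.2 y ∂μ - c)) 2
      (μ.prod μ) := by
  refine ((hL.sub (memLp_const c)).sub ?_).sub ?_
  · exact (hoeff_memLp hF hL c).comp_measurePreserving measurePreserving_fst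
  · exact (hoeff_memLp hF hL c).comp_measurePreserving measurePreserving_snd

lemma hoeff2_deg (hF : StronglyMeasurable (Function.uncurry F))
    (hL : MemLp (Function.uncurry F) 2 (μ.prod μ)) :
    ∀ᵐ x ∂μ, Integrable (fun y => F x y - (∫ p, F p.1 p.2 ∂(μ.prod μ)) -
      (∫ y, F x y ∂μ - ∫ p, F p.1 p.2 ∂(μ.prod μ)) -
      (∫ z, F y z ∂μ - ∫ p, F p.1 p.2 ∂(μ.prod μ))) μ ∧
      ∫ y, (F x y - (∫ p, F p.1 p.2 ∂(μ.prod μ)) -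
      (∫ y, F x y ∂μ - ∫ p, F p.1 p.2 ∂(μ.prod μ)) -
      (∫ z, F y z ∂μ - ∫ p, F p.1 p.2 ∂(μ.prod μ))) ∂μ = 0 := by
  have hi : Integrable (fun p : E × E => F p.1 p.2) (μ.prod μ) := hL.integrable (by norm_num)
  have hm := hoeff_mean hL
  have hi1 : Integrable _ μ := (hoeff_memLp hF hL (∫ p, F p.1 p.2 ∂(μ.prod μ))).integrable (by norm_num)
  filter_upwards [hi.prod_right_ae] with x hx
  set c := ∫ p, F p.1 p.2 ∂(μ.prod μ)
  have i1 : Integrable (fun y => F x y - c) μ := hx.sub (integrable_const c)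
  have i2 : Integrable (fun y => F x y - c - (∫ y, F x y ∂μ - c)) μ := i1.sub (integrable_const _)
  refine ⟨i2.sub hi1, ?_⟩
  rw [integral_sub i2 hi1, integral_sub i1 (integrable_const _), integral_sub hx (integrable_const _),
    hm]
  simp

end hoeff

section quad
variable {Ω : Type*} [MeasurableSpace Ω] {P : Measure Ω} [IsProbabilityMeasure P] {r : ℕ}
  {Y : Ω → EuclideanSpace ℝ (Fin r)}

lemma coord_memLp (hY : MemLp Y 2 P) (i : Fin r) : MemLp (fun ω => Y ω i) 2 P :=
  hY.continuousLinearMap_comp (EuclideanSpace.proj (𝕜 := ℝ) i)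

lemma coord_mean (hY : MemLp Y 2 P) (h0 : ∫ ω, Y ω ∂P = 0) (i : Fin r) : ∫ ω, Y ω i ∂P = 0 := by
  have := (EuclideanSpace.proj (𝕜 := ℝ) i : EuclideanSpace ℝ (Fin r) →L[ℝ] ℝ).integral_comp_comm
    (hY.integrable (by norm_num))
  rw [h0, map_zero] at this
  exact this

lemma quad_eq (hY : MemLp Y 2 P) (h0 : ∫ ω, Y ω ∂P = 0) (a : EuclideanSpace ℝ (Fin r)) :
    quadForm (covM P Y) a = ∫ ω, ⟪a, Y ω⟫ ^ 2 ∂P := by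
  have hi : ∀ i j, Integrable (fun ω => a i * (Y ω i * Y ω j) * a j) P := fun i j =>
    (((coord_memLp hY i).integrable_mul (coord_memLp hY j)).const_mul (a i)).mul_const (a j)
  have : ∀ ω, ⟪a, Y ω⟫ ^ 2 = ∑ i, ∑ j, a i * (Y ω i * Y ω j) * a j := by
    intro ω
    simp only [PiLp.inner_apply, RCLike.inner_apply, conj_trivial]
    rw [pow_two, Finset.sum_mul_sum]
    refine Finset.sum_congr rfl fun i _ => Finset.sum_congr rfl fun j _ => by ring
  simp_rw [this]
  rw [integral_finsetSum _ fun i _ => integrable_finsetSum _ fun j _ => hi i j]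
  unfold quadForm
  refine Finset.sum_congr rfl fun i _ => ?_
  rw [integral_finsetSum _ fun j _ => hi i j]
  refine Finset.sum_congr rfl fun j _ => ?_
  rw [integral_mul_const, integral_const_mul]
  simp [covM, coord_mean hY h0]

lemma quad_dot (Γ : Matrix (Fin r) (Fin r) ℝ) (a : EuclideanSpace ℝ (Fin r)) :
    a.ofLp ⬝ᵥ (Γ.mulVec a.ofLp) = quadForm Γ a := by
  simp [quadForm, dotProduct, Matrix.mulVec, Finset.mul_sum, mul_assoc]

lemma cov_psd (hY : MemLp Y 2 P) (h0 : ∫ ω, Y ω ∂P = 0) : (covM P Y).PosSemidef := by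
  refine Matrix.PosSemidef.of_dotProduct_mulVec_nonneg ?_ ?_
  · ext i j
    simp only [covM, Matrix.conjTranspose_apply, Matrix.of_apply, star_trivial]
    simp_rw [mul_comm]
  · intro x
    have := quad_dot (covM P Y) (WithLp.toLp 2 x)
    simp only [star_trivial] 
    rw [this, quad_eq hY h0]
    positivity

end quad

section asm
variable {r : ℕ}

lemma gauss_pair_cf {Γ1 Γ2 : Matrix (Fin r) (Fin r) ℝ} (h1 : Γ1.PosSemidef) (h2 : Γ2.PosSemidef)
    (a b : EuclideanSpace ℝ (Fin r)) :
    ∫ p, Complex.exp (Complex.I * ((⟪a, p.1⟫ + ⟪b, p.2⟫ : ℝ) : ℂ))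
      ∂((multivariateGaussian 0 Γ1).prod (multivariateGaussian 0 Γ2)) =
    Complex.exp (-((quadForm Γ1 a + quadForm Γ2 b : ℝ) : ℂ) / 2) := by
  have e : ∀ p : EuclideanSpace ℝ (Fin r) × EuclideanSpace ℝ (Fin r),
      Complex.exp (Complex.I * ((⟪a, p.1⟫ + ⟪b, p.2⟫ : ℝ) : ℂ)) =
      Complex.exp (⟪p.1, a⟫ * Complex.I) * Complex.exp (⟪p.2, b⟫ * Complex.I) := by
    intro p
    rw [← Complex.exp_add, real_inner_comm p.1, real_inner_comm p.2]
    push_cast; ring_nf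
  simp_rw [e]
  rw [integral_prod_mul (fun x : EuclideanSpace ℝ (Fin r) => Complex.exp (⟪x, a⟫ * Complex.I))
    (fun x : EuclideanSpace ℝ (Fin r) => Complex.exp (⟪x, b⟫ * Complex.I)),
    ← charFun_apply, ← charFun_apply, charFun_multivariateGaussian h1,
    charFun_multivariateGaussian h2, ← Complex.exp_add, quad_dot, quad_dot]
  simp only [inner_zero_right, inner_zero_left]
  push_cast; ring_nf

lemma quad_smul (Γ : Matrix (Fin r) (Fin r) ℝ) (t : ℝ) (a : EuclideanSpace ℝ (Fin r)) :
    quadForm Γ (t • a) = t ^ 2 * quadForm Γ a := by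
  simp only [quadForm, Finset.mul_sum, PiLp.smul_apply, smul_eq_mul]
  refine Finset.sum_congr rfl fun i _ => Finset.sum_congr rfl fun j _ => by ring

lemma quad_nonneg {Γ : Matrix (Fin r) (Fin r) ℝ} (h : Γ.PosSemidef)
    (a : EuclideanSpace ℝ (Fin r)) : 0 ≤ quadForm Γ a := by
  rw [← quad_dot]
  simpa using h.dotProduct_mulVec_nonneg a.ofLp

lemma gauss_pair_marg {Γ1 Γ2 : Matrix (Fin r) (Fin r) ℝ} (h1 : Γ1.PosSemidef) (h2 : Γ2.PosSemidef)
    (a b : EuclideanSpace ℝ (Fin r)) :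
    Measure.map (fun p => ⟪a, p.1⟫ + ⟪b, p.2⟫)
      ((multivariateGaussian 0 Γ1).prod (multivariateGaussian 0 Γ2)) =
    gaussianReal 0 (Real.toNNReal (quadForm Γ1 a + quadForm Γ2 b)) := by
  have hm : Measurable (fun p : EuclideanSpace ℝ (Fin r) × EuclideanSpace ℝ (Fin r) =>
      ⟪a, p.1⟫ + ⟪b, p.2⟫) := by fun_prop
  have : IsProbabilityMeasure (Measure.map (fun p => ⟪a, p.1⟫ + ⟪b, p.2⟫)
      ((multivariateGaussian 0 Γ1).prod (multivariateGaussian 0 Γ2))) :=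
    Measure.isProbabilityMeasure_map hm.aemeasurable
  refine Measure.ext_of_charFun ?_
  ext t
  rw [charFun_gaussianReal, charFun_apply_real, integral_map hm.aemeasurable (by fun_prop),
    Real.coe_toNNReal _ (add_nonneg (quad_nonneg h1 a) (quad_nonneg h2 b))]
  have := gauss_pair_cf h1 h2 (t • a) (t • b)
  simp only [real_inner_smul_left, quad_smul] at this
  convert! this using 2
  · ext p; push_cast; ring_nf
  · push_cast; ring_nf

lemma assemble {Ω : Type*} [MeasurableSpace Ω] {P : Measure Ω} [IsProbabilityMeasure P]
    {κ : Measure (EuclideanSpace ℝ (Fin r) × EuclideanSpace ℝ (Fin r))} [IsProbabilityMeasure κ]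
    {Z : ℕ → Ω → EuclideanSpace ℝ (Fin r) × EuclideanSpace ℝ (Fin r)}
    (hZ : ∀ n, Measurable (Z n))
    (h : ∀ a b, Tendsto (fun n => ∫ ω, Complex.exp (Complex.I *
        ((⟪a, (Z n ω).1⟫ + ⟪b, (Z n ω).2⟫ : ℝ) : ℂ)) ∂P) atTop
      (𝓝 (∫ p, Complex.exp (Complex.I * ((⟪a, p.1⟫ + ⟪b, p.2⟫ : ℝ) : ℂ)) ∂κ)))
    (g : BoundedContinuousFunction
          (EuclideanSpace ℝ (Fin r) × EuclideanSpace ℝ (Fin r)) ℝ) :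
    Tendsto (fun n => ∫ ω, g (Z n ω) ∂P) atTop (𝓝 (∫ z, g z ∂κ)) := by
  let T : EuclideanSpace ℝ (Fin r) × EuclideanSpace ℝ (Fin r) →
    WithLp 2 (EuclideanSpace ℝ (Fin r) × EuclideanSpace ℝ (Fin r)) := WithLp.toLp 2
  have hT : Measurable T := WithLp.measurable_toLp 2 _
  have hTZ : ∀ n, Measurable (fun ω => T (Z n ω)) := fun n => hT.comp (hZ n)
  let ν : ℕ → ProbabilityMeasure (WithLp 2 (EuclideanSpace ℝ (Fin r) × EuclideanSpace ℝ (Fin r))) :=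
    fun n => ⟨P.map (fun ω => T (Z n ω)), Measure.isProbabilityMeasure_map (hTZ n).aemeasurable⟩
  let ν0 : ProbabilityMeasure (WithLp 2 (EuclideanSpace ℝ (Fin r) × EuclideanSpace ℝ (Fin r))) :=
    ⟨κ.map T, Measure.isProbabilityMeasure_map hT.aemeasurable⟩
  have key : Tendsto ν atTop (𝓝 ν0) := by
    rw [ProbabilityMeasure.tendsto_iff_tendsto_charFun]
    intro t
    have hh := h t.ofLp.1 t.ofLp.2
    have e0 : charFun (ν0 : Measure _) t = ∫ p, Complex.exp (Complex.I *
        ((⟪t.ofLp.1, p.1⟫ + ⟪t.ofLp.2, p.2⟫ : ℝ) : ℂ)) ∂κ := by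
      rw [charFun_apply]
      change ∫ x, _ ∂(κ.map T) = _
      rw [integral_map hT.aemeasurable (by fun_prop)]
      refine integral_congr_ae (ae_of_all _ fun p => ?_)
      simp only [T]
      rw [mul_comm, WithLp.prod_inner_apply, real_inner_comm p.1, real_inner_comm p.2]
    have e1 : ∀ n, charFun (ν n : Measure _) t = ∫ ω, Complex.exp (Complex.I *
        ((⟪t.ofLp.1, (Z n ω).1⟫ + ⟪t.ofLp.2, (Z n ω).2⟫ : ℝ) : ℂ)) ∂P := by
      intro n
      rw [charFun_apply]
      change ∫ x, _ ∂(P.map (fun ω => T (Z n ω))) = _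
      rw [integral_map (hTZ n).aemeasurable (by fun_prop)]
      refine integral_congr_ae (ae_of_all _ fun ω => ?_)
      simp only [T]
      rw [mul_comm, WithLp.prod_inner_apply, real_inner_comm (Z n ω).1, real_inner_comm (Z n ω).2]
    rw [e0]
    simp_rw [e1]
    exact hh
  rw [ProbabilityMeasure.tendsto_iff_forall_integral_tendsto] at key
  have hc : Continuous (WithLp.ofLp :
      WithLp 2 (EuclideanSpace ℝ (Fin r) × EuclideanSpace ℝ (Fin r)) → _) :=
    WithLp.prod_continuous_ofLp 2 _ _
  have k := key (g.compContinuous ⟨WithLp.ofLp, hc⟩)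
  have hgm : StronglyMeasurable (fun x : WithLp 2 (EuclideanSpace ℝ (Fin r) × EuclideanSpace ℝ (Fin r))
      => g (WithLp.ofLp x)) := (g.continuous.comp hc).stronglyMeasurable
  have e0 : ∫ x, (g.compContinuous ⟨WithLp.ofLp, hc⟩) x ∂(ν0 : Measure _) = ∫ z, g z ∂κ := by
    change ∫ x, g (WithLp.ofLp x) ∂(κ.map T) = _
    rw [integral_map hT.aemeasurable hgm.aestronglyMeasurable]
  have e1 : ∀ n, ∫ x, (g.compContinuous ⟨WithLp.ofLp, hc⟩) x ∂(ν n : Measure _) =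
      ∫ ω, g (Z n ω) ∂P := by
    intro n
    change ∫ x, g (WithLp.ofLp x) ∂(P.map (fun ω => T (Z n ω))) = _
    rw [integral_map (hTZ n).aemeasurable hgm.aestronglyMeasurable]
  rw [e0] at k
  simp_rw [e1] at k
  exact k

end asm

section gen
variable {E H Ω : Type*} [MeasurableSpace E] [MeasurableSpace Ω] [NormedAddCommGroup H]
  [NormedSpace ℝ H] {P : Measure Ω} {ν : Measure (E × E)} {h : E → E → H}

lemma gen_memLp (hL : MemLp (Function.uncurry h) 2 ν) {U V : Ω → E}
    (hmp : MeasurePreserving (fun ω => (U ω, V ω)) P ν) :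
    MemLp (fun ω => h (U ω) (V ω)) 2 P := hL.comp_measurePreserving hmp

lemma gen_int (hm : StronglyMeasurable (Function.uncurry h)) {U V : Ω → E}
    (hmp : MeasurePreserving (fun ω => (U ω, V ω)) P ν) :
    ∫ ω, h (U ω) (V ω) ∂P = ∫ p, h p.1 p.2 ∂ν := by
  rw [← hmp.map_eq, integral_map hmp.measurable.aemeasurable]
  exact hm.aestronglyMeasurable

lemma gen_int_zero {μ : Measure E} [IsProbabilityMeasure μ]
    (hi : MemLp (Function.uncurry h) 2 (μ.prod μ))
    (hd : ∀ᵐ x ∂μ, Integrable (fun y => h x y) μ ∧ ∫ y, h x y ∂μ = 0) :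
    ∫ p, h p.1 p.2 ∂(μ.prod μ) = 0 := by
  have h' : Integrable (fun p : E × E => h p.1 p.2) (μ.prod μ) := hi.integrable (by norm_num)
  rw [integral_prod _ h']
  refine integral_eq_zero_of_ae ?_
  filter_upwards [hd] with x hx using hx.2

lemma gen_meas [MeasurableSpace H] [BorelSpace H] (hm : StronglyMeasurable (Function.uncurry h))
    {U V : Ω → E} (hU : Measurable U) (hV : Measurable V) :
    Measurable (fun ω => h (U ω) (V ω)) := hm.measurable.comp (hU.prodMk hV)

end gen

section vec
variable {q r : ℕ} {Ω : Type*} [MeasurableSpace Ω]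

lemma vec_facts (P : Measure Ω) [IsProbabilityMeasure P]
    (X : ℕ → Ω → EuclideanSpace ℝ (Fin q)) (hXm : ∀ i, Measurable (X i))
    (hindep : iIndepFun X P)
    (hident : ∀ i, Measure.map (X i) P = Measure.map (X 0) P)
    (f : EuclideanSpace ℝ (Fin q) → EuclideanSpace ℝ (Fin r)) (hfm : Measurable f)
    (hfsq : Integrable (fun ω => ‖f (X 0 ω - X 1 ω)‖ ^ 2) P) :
    StronglyMeasurable (f1v P X f) ∧ MemLp (f1v P X f) 2 (P.map (X 0)) ∧
    ∫ x, f1v P X f x ∂(P.map (X 0)) = 0 ∧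
    StronglyMeasurable (Function.uncurry (f2v P X f)) ∧
    MemLp (Function.uncurry (f2v P X f)) 2 ((P.map (X 0)).prod (P.map (X 0))) ∧
    (∀ᵐ x ∂(P.map (X 0)), Integrable (fun y => f2v P X f x y) (P.map (X 0)) ∧
      ∫ y, f2v P X f x y ∂(P.map (X 0)) = 0) ∧
    (∀ x y, f2v P X f x y = f2v P X f y x) ∧
    MemLp (fun ω => f1v P X f (X 0 ω)) 2 P ∧ MemLp (fun ω => f2v P X f (X 0 ω) (X 1 ω)) 2 P ∧
    ∫ ω, f1v P X f (X 0 ω) ∂P = 0 ∧ ∫ ω, f2v P X f (X 0 ω) (X 1 ω) ∂P = 0 := by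
  obtain ⟨μ, hμ⟩ : ∃ μ, μ = P.map (X 0) := ⟨_, rfl⟩
  rw [← hμ]
  have hpr : IsProbabilityMeasure μ := hμ ▸ Measure.isProbabilityMeasure_map (hXm 0).aemeasurable
  have hmp := mp_two (P := P) hXm hindep hident (i := 0) (j := 1) (by norm_num)
  obtain ⟨F, hF⟩ : ∃ F : EuclideanSpace ℝ (Fin q) → EuclideanSpace ℝ (Fin q) → EuclideanSpace ℝ (Fin r) , F = fun x y => fS f (x - y) :=
    ⟨_, rfl⟩
  have hfS : Measurable (fS f) := by unfold fS; fun_prop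
  have hsub : Measurable (fun p : EuclideanSpace ℝ (Fin q) × EuclideanSpace ℝ (Fin q) => p.1 - p.2) := by fun_prop
  have hFm : StronglyMeasurable (Function.uncurry F) := by
    rw [hF]; exact (hfS.comp hsub).stronglyMeasurable
  have hfsub : Measurable (fun p : EuclideanSpace ℝ (Fin q) × EuclideanSpace ℝ (Fin q) => f (p.1 - p.2)) := hfm.comp hsub
  have hLf : MemLp (fun p : EuclideanSpace ℝ (Fin q) × EuclideanSpace ℝ (Fin q) => f (p.1 - p.2)) 2 (μ.prod μ) := by
    rw [hμ, ← hmp.map_eq, memLp_map_measure_iff hfsub.aestronglyMeasurable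
      hmp.measurable.aemeasurable]
    refine (memLp_two_iff_integrable_sq_norm ?_).2 hfsq
    exact (hfsub.comp hmp.measurable).aestronglyMeasurable
  have hLf' : MemLp (fun p : EuclideanSpace ℝ (Fin q) × EuclideanSpace ℝ (Fin q) => f (p.2 - p.1)) 2 (μ.prod μ) :=
    hLf.comp_measurePreserving Measure.measurePreserving_swap
  have hFe : Function.uncurry F = fun p : EuclideanSpace ℝ (Fin q) × EuclideanSpace ℝ (Fin q) => (2 : ℝ)⁻¹ • (f (p.1 - p.2) + f (p.2 - p.1)) := by
    ext1 p
    simp only [Function.uncurry, hF, fS, neg_sub]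
  have hFL : MemLp (Function.uncurry F) 2 (μ.prod μ) := by
    rw [hFe]; exact (hLf.add hLf').const_smul (2 : ℝ)⁻¹
  have hF0 : ∫ p, F p.1 p.2 ∂(μ.prod μ) = f0v P X f := by
    have a0 : ∫ p : EuclideanSpace ℝ (Fin q) × EuclideanSpace ℝ (Fin q), f (p.1 - p.2) ∂(μ.prod μ) = f0v P X f := by
      rw [hμ, ← hmp.map_eq, integral_map hmp.measurable.aemeasurable hfsub.aestronglyMeasurable]
      rfl
    have a1 : ∫ p : EuclideanSpace ℝ (Fin q) × EuclideanSpace ℝ (Fin q), f (p.2 - p.1) ∂(μ.prod μ) = f0v P X f := by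
      rw [← a0]
      exact integral_prod_swap (μ := μ) (ν := μ) (fun p : EuclideanSpace ℝ (Fin q) × EuclideanSpace ℝ (Fin q) => f (p.1 - p.2))
    have : ∀ p : EuclideanSpace ℝ (Fin q) × EuclideanSpace ℝ (Fin q), F p.1 p.2 = (2 : ℝ)⁻¹ • (f (p.1 - p.2) + f (p.2 - p.1)) :=
      fun p => congrFun hFe p
    simp_rw [this]
    rw [integral_smul, integral_add (hLf.integrable (by norm_num)) (hLf'.integrable (by norm_num)),
      a0, a1, ← two_smul ℝ, smul_smul]
    norm_num
  obtain ⟨c, hc⟩ : ∃ c, c = f0v P X f := ⟨_, rfl⟩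
  rw [← hc] at hF0
  have hf1 : ∀ x, f1v P X f x = ∫ y, F x y ∂μ - c := by
    intro x
    rw [hμ, integral_map (hXm 0).aemeasurable]
    · rw [hc, hF]; rfl
    · exact (hFm.comp_measurable (measurable_const.prodMk measurable_id)).aestronglyMeasurable
  have hf2 : ∀ x y, f2v P X f x y = F x y - c - (∫ y, F x y ∂μ - c) - (∫ z, F y z ∂μ - c) := by
    intro x y
    rw [← hf1, ← hf1, hc, hF]; rfl
  have hf1m : StronglyMeasurable (f1v P X f) := by
    rw [funext hf1]; exact hoeff_meas hFm c
  have hf1L : MemLp (f1v P X f) 2 μ := by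
    rw [funext hf1]; exact hoeff_memLp hFm hFL c
  have hf10 : ∫ x, f1v P X f x ∂μ = 0 := by
    simp_rw [hf1]; rw [← hF0]; exact hoeff_mean hFL
  have hf2e : Function.uncurry (f2v P X f) =
      fun p : EuclideanSpace ℝ (Fin q) × EuclideanSpace ℝ (Fin q) => F p.1 p.2 - c - (∫ y, F p.1 y ∂μ - c) - (∫ z, F p.2 z ∂μ - c) :=
    funext fun p => hf2 p.1 p.2
  have hf2m : StronglyMeasurable (Function.uncurry (f2v P X f)) := by
    rw [hf2e]
    exact ((hFm.sub stronglyMeasurable_const).sub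
      ((hoeff_meas hFm c).comp_measurable measurable_fst)).sub
      ((hoeff_meas hFm c).comp_measurable measurable_snd)
  have hf2L : MemLp (Function.uncurry (f2v P X f)) 2 (μ.prod μ) := by
    rw [hf2e]; exact hoeff2_memLp hFm hFL c
  have hf2d : ∀ᵐ x ∂μ, Integrable (fun y => f2v P X f x y) μ ∧ ∫ y, f2v P X f x y ∂μ = 0 := by
    simp_rw [hf2]
    rw [← hF0]
    exact hoeff2_deg hFm hFL
  have hf2s : ∀ x y, f2v P X f x y = f2v P X f y x := by
    intro x y
    have : fS f (x - y) = fS f (y - x) := by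
      simp only [fS, neg_sub]; rw [add_comm]
    simp only [f2v, this]
    abel
  have hY1 : MemLp (fun ω => f1v P X f (X 0 ω)) 2 P :=
    hf1L.comp_measurePreserving (by rw [hμ]; exact mp_one hXm hident 0)
  have hY2 : MemLp (fun ω => f2v P X f (X 0 ω) (X 1 ω)) 2 P :=
    gen_memLp hf2L (by rw [hμ]; exact hmp)
  have hY10 : ∫ ω, f1v P X f (X 0 ω) ∂P = 0 := by
    rw [hμ, integral_map (hXm 0).aemeasurable hf1m.aestronglyMeasurable] at hf10
    exact hf10
  have hY20 : ∫ ω, f2v P X f (X 0 ω) (X 1 ω) ∂P = 0 := by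
    rw [gen_int hf2m hmp, ← hμ]
    exact gen_int_zero hf2L hf2d
  exact ⟨hf1m, hf1L, hf10, hf2m, hf2L, hf2d, hf2s, hY1, hY2, hY10, hY20⟩

lemma vec_cf (P : Measure Ω) [IsProbabilityMeasure P] {d : ℕ} (hd : 1 ≤ d)
    (X : ℕ → Ω → EuclideanSpace ℝ (Fin q)) (hXm : ∀ i, Measurable (X i))
    (hindep : iIndepFun X P)
    (hident : ∀ i, Measure.map (X i) P = Measure.map (X 0) P)
    (f : EuclideanSpace ℝ (Fin q) → EuclideanSpace ℝ (Fin r)) (hfm : Measurable f)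
    (hfsq : Integrable (fun ω => ‖f (X 0 ω - X 1 ω)‖ ^ 2) P) (a b : EuclideanSpace ℝ (Fin r)) :
    Tendsto (fun n : ℕ => ∫ ω, Complex.exp (Complex.I *
        ((⟪a, (Real.sqrt n)⁻¹ • ∑ i ∈ range n, f1v P X f (X i ω)⟫ +
          ⟪b, (Real.sqrt (n * d))⁻¹ • ∑ p ∈ range n ×ˢ Icc 1 d,
              f2v P X f (X p.1 ω) (X ((p.1 + p.2) % n) ω)⟫ : ℝ) : ℂ)) ∂P) atTop
      (𝓝 (Complex.exp (-((quadForm (covM P (fun ω => f1v P X f (X 0 ω))) a +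
        quadForm (covM P (fun ω => f2v P X f (X 0 ω) (X 1 ω))) b : ℝ) : ℂ) / 2))) := by
  obtain ⟨hf1m, hf1L, hf10, hf2m, hf2L, hf2d, hf2s, hY1, hY2, hY10, hY20⟩ :=
    vec_facts P X hXm hindep hident f hfm hfsq
  have hd' : (0 : ℝ) < d := by exact_mod_cast hd
  have main := scalar_cyclic (P := P) (h1 := fun x => ⟪a, f1v P X f x⟫)
    (h2 := fun x y => (Real.sqrt d)⁻¹ * ⟪b, f2v P X f x y⟫) hXm hindep hident
    (hf1m.measurable.const_inner) ((hf2m.measurable.const_inner (c := b)).const_mul _)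
    (hf1L.const_inner a)
    (by
      rw [integral_inner (hf1L.integrable (by norm_num)), hf10, inner_zero_right])
    ((hf2L.const_inner b).const_mul _)
    (by
      filter_upwards [hf2d] with x hx
      rw [integral_const_mul, integral_inner hx.1, hx.2, inner_zero_right, mul_zero])
    (fun x y => by rw [hf2s x y]) d
  have hv : ∫ ω, ⟪a, f1v P X f (X 0 ω)⟫ ^ 2 ∂P +
      d * ∫ ω, ((Real.sqrt d)⁻¹ * ⟪b, f2v P X f (X 0 ω) (X 1 ω)⟫) ^ 2 ∂P =
      quadForm (covM P (fun ω => f1v P X f (X 0 ω))) a +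
      quadForm (covM P (fun ω => f2v P X f (X 0 ω) (X 1 ω))) b := by
    rw [quad_eq hY1 hY10, quad_eq hY2 hY20]
    simp_rw [mul_pow, inv_pow, Real.sq_sqrt hd'.le]
    rw [integral_const_mul, ← mul_assoc, mul_inv_cancel₀ hd'.ne', one_mul]
  rw [hv] at main
  refine main.congr fun n => ?_
  refine integral_congr_ae (ae_of_all _ fun ω => ?_)
  simp only [real_inner_smul_right, inner_sum]
  rw [← Finset.mul_sum, Real.sqrt_mul (Nat.cast_nonneg n), mul_inv, mul_add, mul_assoc]

end vec

/-- Proposition 2: for fixed `d ≥ 1`, the pair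
`(√n ∫ f_1 dP̂_n, √(nd) M_{n,d})` converges in distribution to
`N_r(0,Γ_1) ⊗ N_r(0,Γ_2)`. -/
theorem stmt9 {q r : ℕ} {Ω : Type*} [MeasurableSpace Ω] (P : Measure Ω)
    [IsProbabilityMeasure P] {d : ℕ} (hd : 1 ≤ d)
    (X : ℕ → Ω → EuclideanSpace ℝ (Fin q)) (hXm : ∀ i, Measurable (X i))
    (hindep : iIndepFun X P)
    (hident : ∀ i, Measure.map (X i) P = Measure.map (X 0) P)
    (f : EuclideanSpace ℝ (Fin q) → EuclideanSpace ℝ (Fin r)) (hfm : Measurable f)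
    (hfsq : Integrable (fun ω => ‖f (X 0 ω - X 1 ω)‖ ^ 2) P) :
    ∃ κ : Measure (EuclideanSpace ℝ (Fin r) × EuclideanSpace ℝ (Fin r)),
      IsProbabilityMeasure κ ∧
      -- `κ = N_r(0,Γ_1) ⊗ N_r(0,Γ_2)`: every linear functional is centered Gaussian with
      -- variance `aᵀΓ_1 a + bᵀΓ_2 b`
      (∀ a b : EuclideanSpace ℝ (Fin r),
        Measure.map (fun p => ⟪a, p.1⟫ + ⟪b, p.2⟫) κ =
          gaussianReal 0 (Real.toNNReal
            (quadForm (covM P (fun ω => f1v P X f (X 0 ω))) a +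
             quadForm (covM P (fun ω => f2v P X f (X 0 ω) (X 1 ω))) b))) ∧
      -- convergence in distribution of the pair
      ∀ g : BoundedContinuousFunction
          (EuclideanSpace ℝ (Fin r) × EuclideanSpace ℝ (Fin r)) ℝ,
        Tendsto (fun n : ℕ =>
          ∫ ω, g ((Real.sqrt n)⁻¹ • ∑ i ∈ range n, f1v P X f (X i ω),
            (Real.sqrt (n * d))⁻¹ • ∑ p ∈ range n ×ˢ Icc 1 d,
              f2v P X f (X p.1 ω) (X ((p.1 + p.2) % n) ω)) ∂P)
          atTop (𝓝 (∫ z, g z ∂κ)) := by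
  obtain ⟨hf1m, hf1L, hf10, hf2m, hf2L, hf2d, hf2s, hY1, hY2, hY10, hY20⟩ :=
    vec_facts P X hXm hindep hident f hfm hfsq
  have hp1 := cov_psd hY1 hY10
  have hp2 := cov_psd hY2 hY20
  refine ⟨(multivariateGaussian 0 (covM P (fun ω => f1v P X f (X 0 ω)))).prod
    (multivariateGaussian 0 (covM P (fun ω => f2v P X f (X 0 ω) (X 1 ω)))), inferInstance,
    gauss_pair_marg hp1 hp2, fun g => ?_⟩
  refine assemble (Z := fun (n : ℕ) ω => ((Real.sqrt n)⁻¹ • ∑ i ∈ range n, f1v P X f (X i ω),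
            (Real.sqrt (n * d))⁻¹ • ∑ p ∈ range n ×ˢ Icc 1 d,
              f2v P X f (X p.1 ω) (X ((p.1 + p.2) % n) ω))) ?_ ?_ g
  · intro n
    refine Measurable.prodMk ?_ ?_
    · have : Measurable (fun ω => ∑ i ∈ range n, f1v P X f (X i ω)) :=
        Finset.measurable_sum _ fun i _ => hf1m.measurable.comp (hXm i)
      exact this.const_smul (Real.sqrt n)⁻¹
    · have : Measurable (fun ω => ∑ p ∈ range n ×ˢ Icc 1 d,
          f2v P X f (X p.1 ω) (X ((p.1 + p.2) % n) ω)) :=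
        Finset.measurable_sum _ fun p _ => gen_meas hf2m (hXm p.1) (hXm ((p.1 + p.2) % n))
      exact this.const_smul (Real.sqrt (n * d))⁻¹
  · intro a b
    rw [gauss_pair_cf hp1 hp2]
    exact vec_cf P hd X hXm hindep hident f hfm hfsq a b
end
end

section
/- Let X_1, X_2, ... be i.i.d. random vectors in R^q and let f : R^q → R be measurable with Γ_2 := E(f_2(X_1, X_2)²) < ∞. Then for every constant c > 0 and every n ≥ 2, E| n^{-2} Σ_{1 ≤ i ≠ j ≤ n} f_2(X_i, X_j)² - Γ_2 | ≤ n^{-1} Γ_2 + 2·E[ f_2(X_1,X_2)² 1{f_2(X_1,X_2)² > c} ] + c·n^{-1/2}. In particular, E| n^{-2} Σ_{1 ≤ i ≠ j ≤ n} f_2(X_i, X_j)² - Γ_2 | → 0 as n → ∞. -/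
open MeasureTheory ProbabilityTheory Finset Filter
open scoped ENNReal Topology

noncomputable section

/-- Symmetrization `f^s(x) := (f(x) + f(-x))/2` of a scalar kernel. -/
def fSs {q : ℕ} (f : EuclideanSpace ℝ (Fin q) → ℝ) (x : EuclideanSpace ℝ (Fin q)) : ℝ :=
  (2 : ℝ)⁻¹ * (f x + f (-x))

/-- `f_0 := E f(X_1 - X_2)`. -/
def f0s {Ω : Type*} [MeasurableSpace Ω] {q : ℕ} (P : Measure Ω)
    (X : ℕ → Ω → EuclideanSpace ℝ (Fin q)) (f : EuclideanSpace ℝ (Fin q) → ℝ) : ℝ :=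
  ∫ ω, f (X 0 ω - X 1 ω) ∂P

/-- `f_1(x) := E f^s(x - X_1) - f_0`. -/
def f1s {Ω : Type*} [MeasurableSpace Ω] {q : ℕ} (P : Measure Ω)
    (X : ℕ → Ω → EuclideanSpace ℝ (Fin q)) (f : EuclideanSpace ℝ (Fin q) → ℝ)
    (x : EuclideanSpace ℝ (Fin q)) : ℝ :=
  (∫ ω, fSs f (x - X 0 ω) ∂P) - f0s P X f

/-- `f_2(x,y) := f^s(x - y) - f_0 - f_1(x) - f_1(y)`. -/
def f2s {Ω : Type*} [MeasurableSpace Ω] {q : ℕ} (P : Measure Ω)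
    (X : ℕ → Ω → EuclideanSpace ℝ (Fin q)) (f : EuclideanSpace ℝ (Fin q) → ℝ)
    (x y : EuclideanSpace ℝ (Fin q)) : ℝ :=
  fSs f (x - y) - f0s P X f - f1s P X f x - f1s P X f y

def offS (n : ℕ) : Finset (ℕ × ℕ) := (range n ×ˢ range n).filter fun p => p.1 ≠ p.2

lemma offS_card (n : ℕ) : ((offS n).card : ℝ) = (n : ℝ) ^ 2 - n := by
  have h : offS n = (range n).offDiag := by
    ext p; simp [offS, Finset.mem_offDiag, and_assoc]
  rw [h, Finset.offDiag_card, card_range, Nat.cast_sub (Nat.le_mul_self n)]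
  push_cast; ring

lemma overlap_card (n : ℕ) (p : ℕ × ℕ) :
    ((offS n).filter fun r => ¬ (p.1 ≠ r.1 ∧ p.1 ≠ r.2 ∧ p.2 ≠ r.1 ∧ p.2 ≠ r.2)).card ≤ 4 * n := by
  have hsub : ((offS n).filter fun r => ¬ (p.1 ≠ r.1 ∧ p.1 ≠ r.2 ∧ p.2 ≠ r.1 ∧ p.2 ≠ r.2)) ⊆
      (({p.1} ×ˢ range n) ∪ (range n ×ˢ {p.1})) ∪ (({p.2} ×ˢ range n) ∪ (range n ×ˢ {p.2})) := by
    intro r hr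
    simp only [offS, mem_filter, mem_product, mem_range, mem_union, mem_singleton] at hr ⊢
    grind
  refine (card_le_card hsub).trans ((card_union_le _ _).trans ?_)
  refine (add_le_add (card_union_le _ _) (card_union_le _ _)).trans ?_
  simp only [card_product, card_singleton, card_range]
  omega

lemma cov_le_of_var {Ω : Type*} [MeasurableSpace Ω] {P : Measure Ω} [IsProbabilityMeasure P]
    {Y Z : Ω → ℝ} (hY : MemLp Y 2 P) (hZ : MemLp Z 2 P) {v : ℝ}
    (h1 : variance Y P ≤ v) (h2 : variance Z P ≤ v) : covariance Y Z P ≤ v := by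
  have h := variance_nonneg (Y - Z) P
  rw [variance_sub hY hZ] at h
  linarith

lemma trunc_bound {Ω : Type*} [MeasurableSpace Ω] {P : Measure Ω} [IsProbabilityMeasure P]
    (H : ℕ × ℕ → Ω → ℝ) (hm : ∀ p, Measurable (H p)) {c : ℝ} (hc : 0 < c)
    (hb : ∀ p ω, H p ω ∈ Set.Icc 0 c)
    (hind : ∀ p r : ℕ × ℕ, p.1 ≠ r.1 → p.1 ≠ r.2 → p.2 ≠ r.1 → p.2 ≠ r.2 → IndepFun (H p) (H r) P)
    (m : ℝ) (hmean : ∀ p : ℕ × ℕ, p.1 ≠ p.2 → ∫ ω, H p ω ∂P = m) (n : ℕ) (hn : 0 < n) :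
    ∫ ω, |∑ p ∈ offS n, (H p ω - m)| ∂P ≤ (n : ℝ) ^ 2 * (c * (Real.sqrt n)⁻¹) := by
  have hL : ∀ p, MemLp (H p) 2 P := fun p =>
    memLp_of_bounded (a := 0) (b := c) (ae_of_all _ (hb p)) (hm p).aestronglyMeasurable 2
  have hvar : ∀ p, variance (H p) P ≤ (c / 2) ^ 2 := fun p => by
    simpa using variance_le_sq_of_bounded (ae_of_all P (hb p)) (hm p).aemeasurable
  have hn' : (0 : ℝ) < n := by exact_mod_cast hn
  have hV : variance (fun ω => ∑ p ∈ offS n, H p ω) P ≤ (n : ℝ) ^ 3 * c ^ 2 := by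
    rw [variance_fun_sum' (fun p _ => hL p)]
    have h1 : ∀ p ∈ offS n, ∑ r ∈ offS n, covariance (H p) (H r) P ≤ n * c ^ 2 := by
      intro p _
      have h2 : ∑ r ∈ offS n, covariance (H p) (H r) P ≤ ∑ r ∈ offS n,
          if ¬ (p.1 ≠ r.1 ∧ p.1 ≠ r.2 ∧ p.2 ≠ r.1 ∧ p.2 ≠ r.2) then (c / 2) ^ 2 else 0 := by
        refine sum_le_sum fun r _ => ?_
        split_ifs with h
        · exact ((hind p r h.1 h.2.1 h.2.2.1 h.2.2.2).covariance_eq_zero (hL p) (hL r)).le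
        · exact cov_le_of_var (hL p) (hL r) (hvar p) (hvar r)
      refine h2.trans ?_
      rw [← sum_filter, sum_const, nsmul_eq_mul]
      have h3 : (((offS n).filter fun r =>
        ¬ (p.1 ≠ r.1 ∧ p.1 ≠ r.2 ∧ p.2 ≠ r.1 ∧ p.2 ≠ r.2)).card : ℝ) ≤ 4 * n := by
        exact_mod_cast overlap_card n p
      nlinarith [mul_le_mul_of_nonneg_right h3 (sq_nonneg (c / 2))]
    refine (sum_le_sum h1).trans ?_
    rw [sum_const, nsmul_eq_mul, offS_card]
    have : 0 ≤ (n : ℝ) ^ 2 * c ^ 2 := by positivity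
    nlinarith
  have hSL : MemLp (fun ω => ∑ p ∈ offS n, (H p ω - m)) 2 P :=
    memLp_finsetSum _ fun p _ => (hL p).sub (memLp_const m)
  have hint : ∀ p, Integrable (H p) P := fun p => (hL p).integrable (by norm_num)
  have hES : ∫ ω, ∑ p ∈ offS n, H p ω ∂P = ∑ p ∈ offS n, m := by
    rw [integral_finsetSum _ fun p _ => hint p]
    refine sum_congr rfl fun p hp => hmean p (by simpa [offS] using (mem_filter.1 hp).2)
  have hsq : variance (fun ω => ∑ p ∈ offS n, H p ω) P =
      ∫ ω, (∑ p ∈ offS n, (H p ω - m)) ^ 2 ∂P := by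
    rw [variance_eq_integral (Finset.measurable_sum _ fun p _ => hm p).aemeasurable, hES]
    simp only [sum_sub_distrib]
  have hj := variance_nonneg (fun ω => |∑ p ∈ offS n, (H p ω - m)|) P
  have hSLa : MemLp (fun ω => |∑ p ∈ offS n, (H p ω - m)|) 2 P := hSL.abs
  rw [variance_eq_sub hSLa] at hj
  have e : ∫ ω, ((fun ω => |∑ p ∈ offS n, (H p ω - m)|) ^ 2) ω ∂P =
      ∫ ω, (∑ p ∈ offS n, (H p ω - m)) ^ 2 ∂P := by
    simp [sq_abs]
  rw [e, ← hsq] at hj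
  refine abs_le_of_sq_le_sq' ?_ ?_ |>.2
  · have : ((n : ℝ) ^ 2 * (c * (Real.sqrt n)⁻¹)) ^ 2 = (n : ℝ) ^ 3 * c ^ 2 := by
      rw [mul_pow, mul_pow, inv_pow, Real.sq_sqrt hn'.le]
      field_simp
    rw [this]; linarith
  · positivity

lemma main_bound {Ω : Type*} [MeasurableSpace Ω] {P : Measure Ω} [IsProbabilityMeasure P]
    (G : ℕ × ℕ → Ω → ℝ) (hm : ∀ p, Measurable (G p)) (h0 : ∀ p ω, 0 ≤ G p ω)
    (hid : ∀ p : ℕ × ℕ, p.1 ≠ p.2 → IdentDistrib (G p) (G (0, 1)) P P)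
    (hind : ∀ p r : ℕ × ℕ, p.1 ≠ r.1 → p.1 ≠ r.2 → p.2 ≠ r.1 → p.2 ≠ r.2 → IndepFun (G p) (G r) P)
    (hint : Integrable (G (0, 1)) P) (c : ℝ) (hc : 0 < c) (n : ℕ) (hn : 0 < n) :
    ∫ ω, |((n : ℝ) ^ 2)⁻¹ * (∑ p ∈ offS n, G p ω) - ∫ ω', G (0, 1) ω' ∂P| ∂P ≤
      (n : ℝ)⁻¹ * (∫ ω', G (0, 1) ω' ∂P) +
      2 * (∫ ω', if c < G (0, 1) ω' then G (0, 1) ω' else 0 ∂P) + c * (Real.sqrt n)⁻¹ := by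
  have hn' : (0 : ℝ) < n := by exact_mod_cast hn
  have hn1 : (1 : ℝ) ≤ n := by exact_mod_cast hn
  let φ : ℝ → ℝ := fun x => if c < x then 0 else x
  let ψ : ℝ → ℝ := fun x => if c < x then x else 0
  have hφ : Measurable φ := Measurable.ite measurableSet_Ioi measurable_const measurable_id
  have hψ : Measurable ψ := Measurable.ite measurableSet_Ioi measurable_id measurable_const
  have hφψ : ∀ x, x = φ x + ψ x := fun x => by simp only [φ, ψ]; split_ifs <;> simp
  have hφb : ∀ x, 0 ≤ x → φ x ∈ Set.Icc 0 c := fun x hx => by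
    simp only [φ]; split_ifs with h
    · exact ⟨le_rfl, hc.le⟩
    · exact ⟨hx, not_lt.1 h⟩
  have hψ0 : ∀ x, 0 ≤ x → 0 ≤ ψ x := fun x hx => by
    simp only [ψ]; split_ifs <;> simp [hx]
  have hψx : ∀ x, 0 ≤ x → ψ x ≤ x := fun x hx => by
    simp only [ψ]; split_ifs <;> simp [hx]
  have hintG : ∀ p : ℕ × ℕ, p.1 ≠ p.2 → Integrable (G p) P := fun p hp =>
    (hid p hp).integrable_iff.2 hint
  have hintR : ∀ p : ℕ × ℕ, p.1 ≠ p.2 → Integrable (fun ω => ψ (G p ω)) P := fun p hp =>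
    (hintG p hp).mono (hψ.comp (hm p)).aestronglyMeasurable (ae_of_all _ fun ω => by
      rw [Real.norm_of_nonneg (hψ0 _ (h0 p ω)), Real.norm_of_nonneg (h0 p ω)]
      exact hψx _ (h0 p ω))
  have hintH : ∀ p : ℕ × ℕ, Integrable (fun ω => φ (G p ω)) P := fun p =>
    (memLp_of_bounded (a := 0) (b := c) (ae_of_all _ fun ω => hφb _ (h0 p ω))
      (hφ.comp (hm p)).aestronglyMeasurable 1).integrable le_rfl
  set Γ := ∫ ω', G (0, 1) ω' ∂P with hΓ
  set ρ := ∫ ω', (if c < G (0, 1) ω' then G (0, 1) ω' else 0) ∂P with hρ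
  set m := ∫ ω', φ (G (0, 1) ω') ∂P with hmdef
  have hρ0 : 0 ≤ ρ := integral_nonneg fun ω => hψ0 _ (h0 _ ω)
  have hΓ0 : 0 ≤ Γ := integral_nonneg fun ω => h0 _ ω
  have hsplit : Γ = m + ρ := by
    rw [hΓ, hmdef, hρ, ← integral_add (hintH _) (hintR (0, 1) (by simp))]
    exact integral_congr_ae (ae_of_all _ fun ω => hφψ _)
  have hT := trunc_bound (P := P) (fun p ω => φ (G p ω)) (fun p => hφ.comp (hm p)) hc
    (fun p ω => hφb _ (h0 p ω))
    (fun p r a b d e => (hind p r a b d e).comp hφ hφ) m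
    (fun p hp => ((hid p hp).comp hφ).integral_eq) n hn
  have hmem : ∀ p ∈ offS n, p.1 ≠ p.2 := fun p hp => (mem_filter.1 hp).2
  have hER : ∫ ω, ∑ p ∈ offS n, (ψ (G p ω) + ρ) ∂P = ((n : ℝ) ^ 2 - n) * (2 * ρ) := by
    have hi : ∀ p ∈ offS n, Integrable (fun ω => ψ (G p ω) + ρ) P := fun p hp =>
      (hintR p (hmem p hp)).add (integrable_const ρ)
    rw [integral_finsetSum _ hi, ← offS_card, ← nsmul_eq_mul, ← sum_const]
    refine sum_congr rfl fun p hp => ?_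
    rw [integral_add (hintR p (hmem p hp)) (integrable_const ρ)]
    have : ∫ ω, ψ (G p ω) ∂P = ρ := ((hid p (hmem p hp)).comp hψ).integral_eq
    rw [this]; simp; ring
  have hI1 : Integrable (fun ω => |∑ p ∈ offS n, (φ (G p ω) - m)|) P :=
    (integrable_finsetSum _ fun p _ => (hintH p).sub (integrable_const m)).abs
  have hI2 : Integrable (fun ω => ∑ p ∈ offS n, (ψ (G p ω) + ρ)) P :=
    integrable_finsetSum _ fun p hp => (hintR p (hmem p hp)).add (integrable_const ρ)
  have hI3 : Integrable (fun ω => ((n : ℝ) ^ 2)⁻¹ * (∑ p ∈ offS n, G p ω) - Γ) P :=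
    ((integrable_finsetSum _ fun p hp => hintG p (hmem p hp)).const_mul _).sub
      (integrable_const Γ)
  have hpt : ∀ ω, |((n : ℝ) ^ 2)⁻¹ * (∑ p ∈ offS n, G p ω) - Γ| ≤
      ((n : ℝ) ^ 2)⁻¹ * (|∑ p ∈ offS n, (φ (G p ω) - m)| + ∑ p ∈ offS n, (ψ (G p ω) + ρ)) +
        (n : ℝ)⁻¹ * Γ := by
    intro ω
    have e : ((n : ℝ) ^ 2)⁻¹ * (∑ p ∈ offS n, G p ω) - Γ =
        ((n : ℝ) ^ 2)⁻¹ * (∑ p ∈ offS n, (φ (G p ω) - m) + ∑ p ∈ offS n, (ψ (G p ω) - ρ)) -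
          (n : ℝ)⁻¹ * Γ := by
      have e1 : ∑ p ∈ offS n, (φ (G p ω) - m) + ∑ p ∈ offS n, (ψ (G p ω) - ρ) =
          ∑ p ∈ offS n, G p ω - ((n : ℝ) ^ 2 - n) * Γ := by
        rw [← offS_card, ← nsmul_eq_mul, ← sum_const, ← sum_sub_distrib, ← sum_add_distrib]
        refine sum_congr rfl fun p _ => ?_
        rw [hsplit]; linarith [hφψ (G p ω)]
      rw [e1]; field_simp; ring
    rw [e]
    refine (abs_sub _ _).trans ?_
    rw [abs_mul, abs_of_nonneg (a := ((n : ℝ) ^ 2)⁻¹) (by positivity),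
      abs_of_nonneg (a := (n : ℝ)⁻¹ * Γ) (by positivity)]
    gcongr
    refine (abs_add_le _ _).trans ?_
    gcongr
    refine (abs_sum_le_sum_abs _ _).trans (sum_le_sum fun p _ => ?_)
    have := hψ0 _ (h0 p ω)
    rw [abs_le]; constructor <;> linarith
  refine (integral_mono hI3.abs (((hI1.add hI2).const_mul _).add (integrable_const _)) hpt).trans ?_
  have hE : ∫ ω, (((n : ℝ) ^ 2)⁻¹ * (|∑ p ∈ offS n, (φ (G p ω) - m)| +
      ∑ p ∈ offS n, (ψ (G p ω) + ρ)) + (n : ℝ)⁻¹ * Γ) ∂P =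
      ((n : ℝ) ^ 2)⁻¹ * (∫ ω, |∑ p ∈ offS n, (φ (G p ω) - m)| ∂P + ((n : ℝ) ^ 2 - n) * (2 * ρ))
        + (n : ℝ)⁻¹ * Γ := by
    have hi : Integrable (fun ω => ((n : ℝ) ^ 2)⁻¹ * (|∑ p ∈ offS n, (φ (G p ω) - m)| +
      ∑ p ∈ offS n, (ψ (G p ω) + ρ))) P := (hI1.add hI2).const_mul _
    rw [← hER, ← integral_add hI1 hI2, integral_add hi (integrable_const _),
      integral_const_mul]
    simp
  refine hE.trans_le ?_
  have h4 : ((n : ℝ) ^ 2 - n) * (2 * ρ) ≤ (n : ℝ) ^ 2 * (2 * ρ) := by nlinarith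
  calc _ ≤ ((n : ℝ) ^ 2)⁻¹ * ((n : ℝ) ^ 2 * (c * (Real.sqrt n)⁻¹) + (n : ℝ) ^ 2 * (2 * ρ))
        + (n : ℝ)⁻¹ * Γ := by gcongr
    _ = _ := by field_simp; ring

lemma main_tendsto {Ω : Type*} [MeasurableSpace Ω] {P : Measure Ω} [IsProbabilityMeasure P]
    (g : Ω → ℝ) (hg : Integrable g P) (a : ℕ → ℝ) (ha0 : ∀ n, 0 ≤ a n)
    (ha : ∀ c : ℝ, 0 < c → ∀ n : ℕ, 2 ≤ n → a n ≤
      (n : ℝ)⁻¹ * (∫ ω', g ω' ∂P) +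
      2 * (∫ ω', if c < g ω' then g ω' else 0 ∂P) + c * (Real.sqrt n)⁻¹) :
    Tendsto a atTop (𝓝 0) := by
  let d : ℕ → ℝ := fun n => Real.sqrt (Real.sqrt n)
  have hd : Tendsto d atTop atTop :=
    Real.tendsto_sqrt_atTop.comp (Real.tendsto_sqrt_atTop.comp tendsto_natCast_atTop_atTop)
  have h1 : Tendsto (fun n => ∫ ω', (if d n < g ω' then g ω' else 0) ∂P) atTop
      (𝓝 (∫ _, (0 : ℝ) ∂P)) := by
    refine tendsto_integral_of_dominated_convergence (fun ω => ‖g ω‖) (fun n => ?_) hg.norm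
      (fun n => ae_of_all _ fun ω => ?_) (ae_of_all _ fun ω => ?_)
    · have hψ : Measurable (fun x : ℝ => if d n < x then x else 0) :=
        Measurable.ite measurableSet_Ioi measurable_id measurable_const
      exact (hψ.comp_aemeasurable hg.aemeasurable).aestronglyMeasurable
    · split_ifs <;> simp
    · refine tendsto_const_nhds.congr' ?_
      filter_upwards [hd.eventually_ge_atTop (g ω)] with n hn
      rw [if_neg (not_lt.2 hn)]
  have h2 : Tendsto (fun n : ℕ => (n : ℝ)⁻¹ * (∫ ω', g ω' ∂P) +
      2 * (∫ ω', if d n < g ω' then g ω' else 0 ∂P) + (d n)⁻¹) atTop (𝓝 0) := by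
    have := (((tendsto_inv_atTop_zero.comp (tendsto_natCast_atTop_atTop (R := ℝ))).mul_const
      (∫ ω', g ω' ∂P)).add (h1.const_mul 2)).add (tendsto_inv_atTop_zero.comp hd)
    simpa using this
  refine squeeze_zero' (Eventually.of_forall ha0) ?_ h2
  filter_upwards [eventually_ge_atTop 2] with n hn
  have hn' : (0 : ℝ) < n := by exact_mod_cast (by omega : 0 < n)
  have hdp : 0 < d n := Real.sqrt_pos.2 (Real.sqrt_pos.2 hn')
  refine (ha (d n) hdp n hn).trans (le_of_eq ?_)
  have : Real.sqrt n = d n * d n := (Real.mul_self_sqrt (Real.sqrt_nonneg _)).symm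
  rw [this]; field_simp

lemma f2s_meas {q : ℕ} {Ω : Type*} [MeasurableSpace Ω] (P : Measure Ω)
    [IsProbabilityMeasure P]
    (X : ℕ → Ω → EuclideanSpace ℝ (Fin q)) (hXm : ∀ i, Measurable (X i))
    (f : EuclideanSpace ℝ (Fin q) → ℝ) (hfm : Measurable f) :
    Measurable (fun p : EuclideanSpace ℝ (Fin q) × EuclideanSpace ℝ (Fin q) =>
      f2s P X f p.1 p.2) := by
  have hs : Measurable (fSs f) := by
    unfold fSs
    exact (hfm.add (hfm.comp measurable_neg)).const_mul _
  have h1 : Measurable (f1s P X f) := by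
    unfold f1s
    refine Measurable.sub_const ?_ _
    have : Measurable (fun p : EuclideanSpace ℝ (Fin q) × Ω => fSs f (p.1 - X 0 p.2)) :=
      hs.comp (measurable_fst.sub ((hXm 0).comp measurable_snd))
    exact this.stronglyMeasurable.integral_prod_right'.measurable
  unfold f2s
  exact (((hs.comp (measurable_fst.sub measurable_snd)).sub_const _).sub
    (h1.comp measurable_fst)).sub (h1.comp measurable_snd)

theorem stmt11 {q : ℕ} {Ω : Type*} [MeasurableSpace Ω] (P : Measure Ω)
    [IsProbabilityMeasure P]
    (X : ℕ → Ω → EuclideanSpace ℝ (Fin q)) (hXm : ∀ i, Measurable (X i))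
    (hindep : iIndepFun X P)
    (hident : ∀ i, Measure.map (X i) P = Measure.map (X 0) P)
    (f : EuclideanSpace ℝ (Fin q) → ℝ) (hfm : Measurable f)
    (hfsq : Integrable (fun ω => (f (X 0 ω - X 1 ω)) ^ 2) P)
    (hf2sq : Integrable (fun ω => (f2s P X f (X 0 ω) (X 1 ω)) ^ 2) P) :
    (∀ c : ℝ, 0 < c → ∀ n : ℕ, 2 ≤ n →
      ∫ ω, |((n : ℝ) ^ 2)⁻¹ *
            (∑ p ∈ (range n ×ˢ range n).filter fun p => p.1 ≠ p.2,
              (f2s P X f (X p.1 ω) (X p.2 ω)) ^ 2) -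
          ∫ ω', (f2s P X f (X 0 ω') (X 1 ω')) ^ 2 ∂P| ∂P ≤
        (n : ℝ)⁻¹ * (∫ ω', (f2s P X f (X 0 ω') (X 1 ω')) ^ 2 ∂P) +
          2 * (∫ ω', if c < (f2s P X f (X 0 ω') (X 1 ω')) ^ 2 then
                (f2s P X f (X 0 ω') (X 1 ω')) ^ 2 else 0 ∂P) +
          c * (Real.sqrt n)⁻¹) ∧
    Tendsto (fun n : ℕ =>
      ∫ ω, |((n : ℝ) ^ 2)⁻¹ *
            (∑ p ∈ (range n ×ˢ range n).filter fun p => p.1 ≠ p.2,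
              (f2s P X f (X p.1 ω) (X p.2 ω)) ^ 2) -
          ∫ ω', (f2s P X f (X 0 ω') (X 1 ω')) ^ 2 ∂P| ∂P)
      atTop (𝓝 0) := by
  let g : EuclideanSpace ℝ (Fin q) × EuclideanSpace ℝ (Fin q) → ℝ :=
    fun p => (f2s P X f p.1 p.2) ^ 2
  have hg : Measurable g := (f2s_meas P X hXm f hfm).pow_const 2
  have hlaw : ∀ p : ℕ × ℕ, p.1 ≠ p.2 → P.map (fun ω => (X p.1 ω, X p.2 ω)) =
      (P.map (X 0)).prod (P.map (X 0)) := fun p hp => by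
    rw [(hindep.indepFun hp).map_prod_eq_prod_map_map (hXm _).aemeasurable (hXm _).aemeasurable,
      hident, hident p.2]
  have hB := main_bound (P := P) (fun p ω => g (X p.1 ω, X p.2 ω))
    (fun p => hg.comp ((hXm _).prodMk (hXm _))) (fun p ω => sq_nonneg _)
    (fun p hp => by
      have : IdentDistrib (fun ω => (X p.1 ω, X p.2 ω)) (fun ω => (X 0 ω, X 1 ω)) P P :=
        ⟨((hXm _).prodMk (hXm _)).aemeasurable, ((hXm _).prodMk (hXm _)).aemeasurable,
          (hlaw p hp).trans (hlaw (0, 1) (by simp)).symm⟩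
      exact this.comp hg)
    (fun p r a b d e =>
      (hindep.indepFun_prodMk_prodMk hXm p.1 p.2 r.1 r.2 a b d e).comp hg hg)
    hf2sq
  have hA : ∀ c : ℝ, 0 < c → ∀ n : ℕ, 2 ≤ n → _ := fun c hc n hn => hB c hc n (by omega)
  exact ⟨hA, main_tendsto _ hf2sq _ (fun n => integral_nonneg fun ω => abs_nonneg _) hA⟩
end
end
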